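/- arXiv:2503.05922 — 2 statements merged into one kernel-verified Lean document; each statement's English description precedes it below -/
import Mathlib

section
/- Let α ≠ 0 be real and β ≥ max{0, −α}. Define the operator T_{α,β} on measurable functions on (0,1) by T_{α,β}f(t) = t^β ∫_t^1 |f(s)| s^{−1+α} ds for t ∈ (0,1). Then for every rearrangement-invariant function norm ‖·‖_X over (0,1) and every measurable f on (0,1): ‖T_{α,β}f‖_X ≤ max{1/|α|, 1/(β+1)} ‖f‖_X. -/
open MeasureTheory Set Filter Topology
open scoped ENNReal NNReal

noncomputable section

/-- The nonincreasing rearrangement of an `ℝ≥0∞`-valued function with respect to `μ`: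
`f^*(t) = inf {λ : μ({f > λ}) ≤ t}`. -/
def rearr {α : Type*} [MeasurableSpace α] (μ : Measure α) (f : α → ℝ≥0∞) (t : ℝ) : ℝ≥0∞ :=
  sInf {l : ℝ≥0∞ | μ {x | l < f x} ≤ ENNReal.ofReal t}

/-- A rearrangement-invariant function norm over the measure space `(α, μ)`, acting on
nonnegative (`ℝ≥0∞`-valued) measurable functions. -/
structure RINorm {α : Type*} [MeasurableSpace α] (μ : Measure α) where
  N : (α → ℝ≥0∞) → ℝ≥0∞
  add_le : ∀ f g : α → ℝ≥0∞, Measurable f → Measurable g →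
    N (fun x => f x + g x) ≤ N f + N g
  smul_eq : ∀ (c : ℝ≥0) (f : α → ℝ≥0∞), Measurable f →
    N (fun x => (c : ℝ≥0∞) * f x) = (c : ℝ≥0∞) * N f
  eq_zero_iff : ∀ f : α → ℝ≥0∞, Measurable f → (N f = 0 ↔ f =ᵐ[μ] 0)
  mono : ∀ f g : α → ℝ≥0∞, Measurable f → Measurable g →
    (∀ᵐ x ∂μ, f x ≤ g x) → N f ≤ N g
  fatou : ∀ (F : ℕ → α → ℝ≥0∞) (f : α → ℝ≥0∞), (∀ k, Measurable (F k)) → Measurable f →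
    (∀ᵐ x ∂μ, Monotone fun k => F k x) → (∀ᵐ x ∂μ, (⨆ k, F k x) = f x) →
    (⨆ k, N (F k)) = N f
  indicator_lt_top : ∀ E : Set α, MeasurableSet E → μ E < ∞ →
    N (E.indicator fun _ => 1) < ∞
  exists_integral_le : ∀ E : Set α, MeasurableSet E → μ E < ∞ → ∃ C : ℝ≥0∞, C < ∞ ∧
    ∀ f : α → ℝ≥0∞, Measurable f → (∫⁻ x in E, f x ∂μ) ≤ C * N f
  rearr_invariant : ∀ f g : α → ℝ≥0∞, Measurable f → Measurable g →
    (∀ l : ℝ≥0∞, μ {x | l < f x} = μ {x | l < g x}) → N f = N g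


/-- Lebesgue measure on `(0,1)`. -/
def μU : Measure ℝ := volume.restrict (Set.Ioo (0 : ℝ) 1)


lemma ri_zero {μ : Measure ℝ} (X : RINorm μ) : X.N (fun _ => 0) = 0 :=
  (X.eq_zero_iff _ measurable_const).2 (Filter.EventuallyEq.refl _ _)

lemma ri_sum {μ : Measure ℝ} (X : RINorm μ) {ι : Type*} (s : Finset ι) (g : ι → ℝ → ℝ≥0∞)
    (hg : ∀ i, Measurable (g i)) :
    X.N (fun x => ∑ i ∈ s, g i x) ≤ ∑ i ∈ s, X.N (g i) := by
  classical
  induction s using Finset.induction_on with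
  | empty => simp [ri_zero]
  | insert a s ha ih =>
    simp only [Finset.sum_insert ha]
    exact (X.add_le _ _ (hg a) (Finset.measurable_fun_sum s fun i _ => hg i)).trans
      (by gcongr)

lemma ri_liminf {μ : Measure ℝ} (X : RINorm μ) (h : ℕ → ℝ → ℝ≥0∞) (g : ℝ → ℝ≥0∞)
    (hh : ∀ n, Measurable (h n)) (hg : Measurable g) (B : ℝ≥0∞) (hB : ∀ᶠ n in atTop, X.N (h n) ≤ B)
    (hl : ∀ᵐ x ∂μ, g x ≤ liminf (fun n => h n x) atTop) : X.N g ≤ B := by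
  let F : ℕ → ℝ → ℝ≥0∞ := fun k x => ⨅ i, ⨅ (_ : i ≥ k), h i x
  have hF : ∀ k, Measurable (F k) := fun k => Measurable.iInf fun i => Measurable.iInf fun _ => hh i
  have hL : Measurable (fun x => ⨆ k, F k x) := Measurable.iSup hF
  have h1 := X.fatou F _ hF hL (Eventually.of_forall fun x => by
    intro a b hab
    refine le_iInf fun i => le_iInf fun hi => ?_
    exact iInf₂_le i (le_trans hab hi)) (Eventually.of_forall fun x => rfl)
  have h2 : X.N g ≤ X.N (fun x => ⨆ k, F k x) := by
    refine X.mono _ _ hg hL ?_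
    filter_upwards [hl] with x hx
    rwa [Filter.liminf_eq_iSup_iInf_of_nat] at hx
  refine h2.trans ?_
  rw [← h1]
  refine iSup_le fun k => ?_
  obtain ⟨n, hn, hnk⟩ := (hB.and (eventually_ge_atTop k)).exists
  refine le_trans (X.mono _ _ (hF k) (hh n) (Eventually.of_forall fun x => ?_)) hn
  exact iInf₂_le n hnk

lemma meas_sum_ind {μ : Measure ℝ} {ι : Type*} [Fintype ι] (P : ι → Set ℝ) (c : ι → ℝ≥0∞)
    (hP : ∀ i, MeasurableSet (P i)) (hd : Pairwise (fun i j => Disjoint (P i) (P j))) (a l : ℝ≥0∞)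
    (ha : ∀ i, μ (P i) = a) :
    μ {x | l < ∑ i, (P i).indicator (fun _ => c i) x} =
      ∑ i ∈ Finset.univ.filter (fun i => l < c i), a := by
  classical
  have hval : ∀ i x, x ∈ P i → ∑ k, (P k).indicator (fun _ => c k) x = c i := by
    intro i x hx
    rw [Finset.sum_eq_single i]
    · simp [hx]
    · intro k _ hk
      exact Set.indicator_of_notMem (fun h => Set.disjoint_left.1 (hd hk) h hx) _
    · simp
  have : {x | l < ∑ i, (P i).indicator (fun _ => c i) x} =
      ⋃ i ∈ Finset.univ.filter (fun i => l < c i), P i := by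
    ext x
    simp only [mem_ofPred_eq, Finset.mem_filter, Finset.mem_univ, true_and, mem_iUnion,
      exists_prop]
    constructor
    · intro h
      by_cases hx : ∃ i, x ∈ P i
      · obtain ⟨i, hi⟩ := hx
        rw [hval i x hi] at h
        exact ⟨i, h, hi⟩
      · push Not at hx
        simp [hx] at h
    · rintro ⟨i, hi, hx⟩
      rwa [hval i x hx]
  rw [this, measure_biUnion_finset (fun i _ j _ hij => hd hij) (fun i _ => hP i)]
  exact Finset.sum_congr rfl fun i _ => ha i

lemma birk {n : ℕ} {ι : Type*} [Fintype ι] (hc : Fintype.card ι ≤ n) (M : Fin n → ι → ℝ)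
    (h0 : ∀ j i, 0 ≤ M j i) (hr : ∀ j, ∑ i, M j i ≤ 1) (hcol : ∀ i, ∑ j, M j i ≤ 1) :
    ∃ w : Equiv.Perm (Fin n) → ℝ≥0, ∑ σ, w σ = 1 ∧ ∃ e : Equiv.Perm (Fin n) → ι → Fin n,
      (∀ σ, Function.Injective (e σ)) ∧
      ∀ j i, M j i ≤ ∑ σ, (w σ : ℝ) * if e σ i = j then 1 else 0 := by
  classical
  obtain ⟨e0⟩ : Nonempty (ι ↪ Fin n) := Function.Embedding.nonempty_of_card_le (by simpa using hc)
  let A : Fin n → Fin n → ℝ := fun j k => ∑ i, if e0 i = k then M j i else 0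
  have hA0 : ∀ j k, 0 ≤ A j k := fun j k => Finset.sum_nonneg fun i _ => by
    split_ifs
    exacts [h0 _ _, le_rfl]
  have hAe : ∀ j i, A j (e0 i) = M j i := by
    intro j i
    simp only [A, e0.injective.eq_iff]
    simp
  let r : Fin n → ℝ := fun j => ∑ k, A j k
  let s : Fin n → ℝ := fun k => ∑ j, A j k
  have hr1 : ∀ j, r j ≤ 1 := by
    intro j
    simp only [r, A]
    rw [Finset.sum_comm]
    simpa using hr j
  have hs1 : ∀ k, s k ≤ 1 := by
    intro k
    by_cases hk : ∃ i, e0 i = k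
    · obtain ⟨i, rfl⟩ := hk
      simpa [s, hAe] using hcol i
    · push Not at hk
      simp [s, A, hk]
  let S : ℝ := ∑ j, (1 - r j)
  have hS' : S = ∑ k, (1 - s k) := by
    simp only [S, Finset.sum_sub_distrib, r, s]
    rw [Finset.sum_comm]
  have hS0 : 0 ≤ S := Finset.sum_nonneg fun j _ => by linarith [hr1 j]
  have key1 : ∀ j, (1 - r j) * S / S = 1 - r j := by
    intro j
    rcases eq_or_ne S 0 with h | h
    · have := (Finset.sum_eq_zero_iff_of_nonneg (fun j _ => by linarith [hr1 j])).1 h j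
        (Finset.mem_univ _)
      simp [this]
    · field_simp
  have key2 : ∀ k, (1 - s k) * S / S = 1 - s k := by
    intro k
    rcases eq_or_ne S 0 with h | h
    · rw [hS'] at h
      have := (Finset.sum_eq_zero_iff_of_nonneg (fun j _ => by linarith [hs1 j])).1 h k
        (Finset.mem_univ _)
      simp [this]
    · field_simp
  let B : Matrix (Fin n) (Fin n) ℝ := fun j k => A j k + (1 - r j) * (1 - s k) / S
  have hB0 : ∀ j k, 0 ≤ (1 - r j) * (1 - s k) / S := fun j k =>
    div_nonneg (mul_nonneg (by linarith [hr1 j]) (by linarith [hs1 k])) hS0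
  have hB : B ∈ doublyStochastic ℝ (Fin n) := by
    rw [mem_doublyStochastic_iff_sum]
    refine ⟨fun j k => add_nonneg (hA0 j k) (hB0 j k), fun j => ?_, fun k => ?_⟩
    · simp only [B, Finset.sum_add_distrib]
      rw [← Finset.sum_div, ← Finset.mul_sum, ← hS', key1]
      simp [r]
    · simp only [B, Finset.sum_add_distrib]
      rw [← Finset.sum_div, ← Finset.sum_mul, mul_comm, key2]
      simp [s]
  obtain ⟨w, hw0, hw1, hwB⟩ := exists_eq_sum_perm_of_mem_doublyStochastic hB
  lift w to Equiv.Perm (Fin n) → ℝ≥0 using hw0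
  refine ⟨w, ?_, fun σ i => σ.symm (e0 i), fun σ => ?_, fun j i => ?_⟩
  · have hw1' : ∑ σ, (w σ : ℝ) = 1 := hw1
    exact_mod_cast hw1'
  · exact σ.symm.injective.comp e0.injective
  · have h1 : M j i ≤ B j (e0 i) := by
      rw [← hAe]
      exact le_add_of_nonneg_right (hB0 _ _)
    refine h1.trans (le_of_eq ?_)
    rw [← hwB, Matrix.sum_apply]
    refine Finset.sum_congr rfl fun σ _ => ?_
    simp only [Matrix.smul_apply, smul_eq_mul, PEquiv.toMatrix_apply,
      Equiv.toPEquiv_apply, Option.mem_def, Option.some.injEq]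
    congr 1
    simp only [Equiv.symm_apply_eq]
    simp only [eq_comm]

lemma split_set (E : Set ℝ) (hE : MeasurableSet E) (hE1 : E ⊆ Ioo 0 1) :
    ∃ P : ℕ → ℕ → Set ℝ, (∀ n k, MeasurableSet (P n k)) ∧ (∀ n k, P n k ⊆ E) ∧
      (∀ (n k l : ℕ), k ≠ l → Disjoint (P n k) (P n l)) ∧
      (∀ (n k : ℕ), 0 < n → k < ⌊(n : ℝ) * volume.real E⌋₊ → volume (P n k) = ENNReal.ofReal (1 / n)) ∧
      (∀ᵐ s, s ∈ E → ∀ᶠ n : ℕ in atTop, ∃ k < ⌊(n : ℝ) * volume.real E⌋₊, s ∈ P n k) := by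
  set m := volume.real E with hm
  have hfin : ∀ A : Set ℝ, A ⊆ E → volume A ≠ ∞ := fun A hA =>
    ((measure_mono (hA.trans hE1)).trans_lt (by simp)).ne
  let F : ℝ → ℝ := fun x => volume.real (E ∩ Iic x)
  have hFmono : Monotone F := fun x y hxy =>
    measureReal_mono (inter_subset_inter_right _ (Iic_subset_Iic.2 hxy)) (hfin _ inter_subset_left)
  have hFlip : ∀ x y, x ≤ y → F y ≤ F x + (y - x) := by
    intro x y hxy
    have h1 : F y ≤ volume.real ((E ∩ Iic x) ∪ Ioc x y) := by
      refine measureReal_mono ?_ ?_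
      · rintro z ⟨hz, hzy⟩
        rcases le_or_gt z x with h | h
        · exact Or.inl ⟨hz, h⟩
        · exact Or.inr ⟨h, hzy⟩
      · exact (measure_union_lt_top (hfin _ inter_subset_left).lt_top (by simp)).ne
    refine h1.trans ((measureReal_union_le _ _).trans ?_)
    simp [F, hxy]
  have hFc : Continuous F := by
    refine (LipschitzWith.of_dist_le_mul (K := 1) fun x y => ?_).continuous
    simp only [Real.dist_eq, NNReal.coe_one, one_mul]
    rcases le_total x y with h | h
    · rw [abs_sub_comm, abs_sub_comm x, abs_of_nonneg (by linarith [hFmono h]),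
        abs_of_nonneg (by linarith)]
      linarith [hFlip _ _ h]
    · rw [abs_of_nonneg (by linarith [hFmono h]), abs_of_nonneg (by linarith)]
      linarith [hFlip _ _ h]
  have hF0 : F 0 = 0 := by
    have : E ∩ Iic 0 = ∅ := by
      ext z
      simp only [mem_inter_iff, mem_Iic, mem_empty_iff_false, iff_false, not_and, not_le]
      exact fun hz => (hE1 hz).1
    simp [F, this]
  have hF1 : F 1 = m := by
    have : E ∩ Iic 1 = E := inter_eq_left.2 fun z hz => (hE1 hz).2.le
    simp [F, this, hm]
  have hx : ∀ u ∈ Icc 0 m, ∃ x, F x = u := by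
    intro u hu
    have := intermediate_value_Icc (zero_le_one (α := ℝ)) (f := F) hFc.continuousOn
    rw [hF0, hF1] at this
    obtain ⟨x, _, hx⟩ := this hu
    exact ⟨x, hx⟩
  have hFm : ∀ u, MeasurableSet {s | F s < u} := fun u =>
    measurableSet_lt hFc.measurable measurable_const
  have hlev : ∀ u ∈ Icc 0 m, volume.real (E ∩ {s | F s < u}) = u := by
    intro u hu
    apply le_antisymm
    · obtain ⟨x, hx⟩ := hx u hu
      have : volume.real (E ∩ {s | F s < u}) ≤ F x := by
        refine measureReal_mono ?_ (hfin _ inter_subset_left)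
        rintro z ⟨hz, hzu⟩
        refine ⟨hz, ?_⟩
        by_contra h
        simp only [mem_Iic, not_le] at h
        have := hFmono h.le
        simp only [mem_ofPred_eq] at hzu
        linarith
      linarith
    · apply le_of_forall_lt
      intro v hv
      rcases lt_or_ge v 0 with h0 | h0
      · exact h0.trans_le measureReal_nonneg
      · obtain ⟨v', hv1, hv2⟩ := exists_between hv
        obtain ⟨x, hx⟩ := hx v' ⟨by linarith, by linarith [hu.2]⟩
        have : F x ≤ volume.real (E ∩ {s | F s < u}) := by
          refine measureReal_mono ?_ (hfin _ inter_subset_left)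
          rintro z ⟨hz, hzx⟩
          refine ⟨hz, ?_⟩
          have := hFmono hzx
          simp only [mem_ofPred_eq]
          linarith
        linarith
  refine ⟨fun n k => (E ∩ {s | F s < (k + 1) / n}) \ (E ∩ {s | F s < k / n}), ?_, ?_, ?_, ?_, ?_⟩
  · exact fun n k => (hE.inter (hFm _)).diff (hE.inter (hFm _))
  · exact fun n k => sdiff_subset.trans inter_subset_left
  · intro n
    have : ∀ k l : ℕ, k < l → Disjoint ((E ∩ {s | F s < (k + 1) / n}) \ (E ∩ {s | F s < k / n}))
        ((E ∩ {s | F s < (l + 1) / n}) \ (E ∩ {s | F s < l / n})) := by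
      intro k l hkl
      rw [Set.disjoint_left]
      rintro z ⟨⟨hz, hz1⟩, _⟩ ⟨_, h⟩
      apply h
      refine ⟨hz, ?_⟩
      simp only [mem_ofPred_eq] at hz1 ⊢
      refine hz1.trans_le ?_
      gcongr
      exact_mod_cast hkl
    intro k l hkl
    rcases lt_or_gt_of_ne hkl with h | h
    · exact this _ _ h
    · exact (this _ _ h).symm
  · intro n k hn hk
    have hn' : (0 : ℝ) < n := by exact_mod_cast hn
    have hk1 : ((k + 1 : ℕ) : ℝ) ≤ n * m := (Nat.le_floor_iff (by positivity)).1 hk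
    push_cast at hk1
    have hk2 : ((k : ℝ) + 1) / n ≤ m := by rw [div_le_iff₀ hn']; linarith
    have hk3 : (k : ℝ) / n ≤ (k + 1) / n := by gcongr; linarith
    have h1 := hlev ((k + 1) / n) ⟨by positivity, hk2⟩
    have h2 := hlev (k / n) ⟨by positivity, hk3.trans hk2⟩
    have hsub : E ∩ {s | F s < k / n} ⊆ E ∩ {s | F s < (k + 1) / n} := by
      rintro z ⟨hz, hz1⟩
      exact ⟨hz, lt_of_lt_of_le hz1 hk3⟩
    rw [← ofReal_measureReal (hfin _ (sdiff_subset.trans inter_subset_left)),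
      measureReal_sdiff hsub (hE.inter (hFm _)) (h₁ := hfin _ inter_subset_left), h1, h2]
    congr 1
    field_simp
    ring
  · have hnull : volume (E \ (E ∩ {s | F s < m})) = 0 := by
      rw [← ofReal_measureReal (hfin _ sdiff_subset),
        measureReal_sdiff inter_subset_left (hE.inter (hFm _)) (h₁ := hfin _ subset_rfl),
        hlev m ⟨measureReal_nonneg, le_rfl⟩, ← hm]
      simp
    have hae : ∀ᵐ s, s ∉ E \ (E ∩ {s | F s < m}) := measure_eq_zero_iff_ae_notMem.1 hnull
    filter_upwards [hae] with s hs hsE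
    have hsm : F s < m := by
      by_contra h
      exact hs ⟨hsE, fun h' => h h'.2⟩
    have hFs : 0 ≤ F s := measureReal_nonneg
    have : ∀ᶠ n : ℕ in atTop, 1 / (m - F s) ≤ n := eventually_atTop.2 ⟨⌈1 / (m - F s)⌉₊,
      fun n hn => Nat.ceil_le.1 hn⟩
    filter_upwards [this, eventually_gt_atTop 0] with n hn hn0
    have hn' : (0 : ℝ) < n := by exact_mod_cast hn0
    rw [div_le_iff₀ (by linarith)] at hn
    refine ⟨⌊n * F s⌋₊, ?_, ⟨hsE, ?_⟩, ?_⟩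
    · apply Nat.lt_of_succ_le
      apply Nat.le_floor
      push_cast
      have := Nat.floor_le (a := n * F s) (by positivity)
      linarith
    · simp only [mem_ofPred_eq]
      rw [lt_div_iff₀ hn', mul_comm]
      exact Nat.lt_floor_add_one _
    · rintro ⟨_, h⟩
      simp only [mem_ofPred_eq] at h
      rw [lt_div_iff₀ hn', mul_comm] at h
      exact absurd (Nat.floor_le (a := n * F s) (by positivity)) (not_le.2 h)

lemma row_bound (α β a b : ℝ) (hα : α ≠ 0) (hβ : max 0 (-α) ≤ β) (ha : 0 ≤ a) (hab : a ≤ b)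
    (hb0 : 0 < b) (hb1 : b ≤ 1) :
    ENNReal.ofReal (a ^ β) * ∫⁻ s in Ioo b 1, ENNReal.ofReal (s ^ (-1 + α))
      ≤ ENNReal.ofReal (1 / |α|) := by
  have hβ0 : 0 ≤ β := (le_max_left _ _).trans hβ
  have hβ1 : 0 ≤ β + α := by linarith [(le_max_right 0 (-α)).trans hβ]
  have hni : (0 : ℝ) ∉ uIcc b 1 := by
    rw [uIcc_of_le hb1]
    exact fun h => absurd h.1 (not_le.2 hb0)
  have hint : IntegrableOn (fun s : ℝ => s ^ (-1 + α)) (Ioo b 1) := by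
    have : IntervalIntegrable (fun s : ℝ => s ^ (-1 + α)) volume b 1 :=
      intervalIntegral.intervalIntegrable_rpow (Or.inr hni)
    rw [intervalIntegrable_iff_integrableOn_Ioo_of_le hb1] at this
    exact this
  rw [← ofReal_integral_eq_lintegral_ofReal hint, ← integral_Ioc_eq_integral_Ioo,
    ← intervalIntegral.integral_of_le hb1, integral_rpow (Or.inr ⟨by
      intro h; apply hα; linarith, hni⟩), ← ENNReal.ofReal_mul (by positivity)]
  · apply ENNReal.ofReal_le_ofReal
    have e : -1 + α + 1 = α := by ring
    rw [e, Real.one_rpow]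
    have hba : 0 < b ^ α := Real.rpow_pos_of_pos hb0 _
    have haβ0 : 0 ≤ a ^ β := Real.rpow_nonneg ha _
    have hab' : a ^ β ≤ b ^ β := Real.rpow_le_rpow ha hab hβ0
    have hb' : b ^ β ≤ 1 := Real.rpow_le_one hb0.le hb1 hβ0
    have hbb : b ^ β * b ^ α ≤ 1 := by
      rw [← Real.rpow_add hb0]
      exact Real.rpow_le_one hb0.le hb1 hβ1
    rcases lt_or_gt_of_ne hα with h | h
    · rw [abs_of_neg h, ← mul_div_assoc, ← neg_div_neg_eq]
      apply div_le_div_of_nonneg_right _ (by linarith)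
      nlinarith [mul_le_mul_of_nonneg_right hab' hba.le]
    · rw [abs_of_pos h, ← mul_div_assoc]
      apply div_le_div_of_nonneg_right _ h.le
      nlinarith [mul_nonneg haβ0 hba.le]
  · filter_upwards [ae_restrict_mem measurableSet_Ioo] with s hs
    exact Real.rpow_nonneg (hb0.le.trans hs.1.le) _

lemma sum_pow_le (β : ℝ) (hβ : 0 ≤ β) (m : ℕ) :
    ∑ j ∈ Finset.range m, (j : ℝ) ^ β ≤ (m : ℝ) ^ (β + 1) / (β + 1) := by
  have := MonotoneOn.sum_le_integral (f := fun x : ℝ => x ^ β) (x₀ := 0) (a := m)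
    (fun x hx y hy hxy => Real.rpow_le_rpow hx.1 hxy hβ)
  simp only [zero_add] at this
  rw [integral_rpow (Or.inl (by linarith)), Real.zero_rpow (by linarith), sub_zero] at this
  exact this

lemma col_point (α β : ℝ) (hβ : max 0 (-α) ≤ β) (n : ℕ) (hn : 0 < n) (s : ℝ) (hs : s ∈ Ioo (0:ℝ) 1) :
    ∑ j : Fin n, ENNReal.ofReal (((j : ℕ) / n : ℝ) ^ β) *
      (Ioo (((j : ℕ) + 1 : ℝ) / n) 1).indicator (fun s => ENNReal.ofReal (s ^ (-1 + α))) s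
      ≤ ENNReal.ofReal (n / (β + 1)) := by
  have hβ0 : 0 ≤ β := (le_max_left _ _).trans hβ
  have hβ1 : 0 ≤ α + β := by linarith [(le_max_right 0 (-α)).trans hβ]
  have hn' : (0 : ℝ) < n := by exact_mod_cast hn
  have hs0 := hs.1
  have hsp : 0 < s ^ (-1 + α) := Real.rpow_pos_of_pos hs0 _
  set m := ⌊n * s⌋₊ with hm
  have hmle : (m : ℝ) ≤ n * s := Nat.floor_le (by positivity)
  have h1 : ∀ j ∈ Finset.range n, ENNReal.ofReal ((j / n : ℝ) ^ β) *
      (Ioo ((j + 1 : ℝ) / n) 1).indicator (fun s => ENNReal.ofReal (s ^ (-1 + α))) s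
      ≤ ENNReal.ofReal (if j < m then (j / n : ℝ) ^ β * s ^ (-1 + α) else 0) := by
    intro j _
    by_cases h : s ∈ Ioo ((j + 1 : ℝ) / n) 1
    · have : j < m := by
        apply Nat.lt_of_succ_le
        apply Nat.le_floor
        have := h.1
        rw [div_lt_iff₀ hn'] at this
        push_cast
        linarith
      rw [Set.indicator_of_mem h, if_pos this, ENNReal.ofReal_mul (by positivity)]
    · rw [Set.indicator_of_notMem h]
      simp
  rw [Fin.sum_univ_eq_sum_range (fun j => ENNReal.ofReal ((j / n : ℝ) ^ β) *
      (Ioo ((j + 1 : ℝ) / n) 1).indicator (fun s => ENNReal.ofReal (s ^ (-1 + α))) s) n]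
  refine (Finset.sum_le_sum h1).trans ?_
  rw [← ENNReal.ofReal_sum_of_nonneg (fun j _ => by split_ifs <;> positivity)]
  apply ENNReal.ofReal_le_ofReal
  rw [← Finset.sum_filter]
  have h2 : ∑ j ∈ (Finset.range n).filter (fun j => j < m), (j / n : ℝ) ^ β * s ^ (-1 + α) ≤
      ∑ j ∈ Finset.range m, (j / n : ℝ) ^ β * s ^ (-1 + α) := by
    apply Finset.sum_le_sum_of_subset_of_nonneg
    · intro j hj
      simpa using (Finset.mem_filter.1 hj).2
    · intros
      positivity
  refine h2.trans ?_
  have h3 : ∑ j ∈ Finset.range m, (j / n : ℝ) ^ β * s ^ (-1 + α) =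
      (∑ j ∈ Finset.range m, (j : ℝ) ^ β) * (s ^ (-1 + α) / n ^ β) := by
    rw [Finset.sum_mul]
    refine Finset.sum_congr rfl fun j _ => ?_
    rw [Real.div_rpow (by positivity) (by positivity)]
    ring
  rw [h3]
  have h4 : ∑ j ∈ Finset.range m, (j : ℝ) ^ β ≤ (n * s) ^ (β + 1) / (β + 1) :=
    (sum_pow_le β hβ0 m).trans (by gcongr)
  calc (∑ j ∈ Finset.range m, (j : ℝ) ^ β) * (s ^ (-1 + α) / n ^ β)
      ≤ (n * s) ^ (β + 1) / (β + 1) * (s ^ (-1 + α) / n ^ β) := by gcongr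
    _ = n / (β + 1) * s ^ (α + β) := by
      rw [Real.mul_rpow hn'.le hs0.le, Real.rpow_add hn', Real.rpow_one,
        show α + β = (β + 1) + (-1 + α) by ring, Real.rpow_add hs0 (β + 1)]
      have : (n : ℝ) ^ β ≠ 0 := (Real.rpow_pos_of_pos hn' _).ne'
      field_simp
    _ ≤ n / (β + 1) * 1 := by
      gcongr
      exact Real.rpow_le_one hs0.le hs.2.le hβ1
    _ = _ := mul_one _

lemma core (X : RINorm μU) (α β : ℝ) (hα : α ≠ 0) (hβ : max 0 (-α) ≤ β) (C : ℝ) (hC : 0 < C)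
    (hC1 : 1 / |α| ≤ C) (hC2 : 1 / (β + 1) ≤ C) (n : ℕ) (hn : 0 < n) {ι : Type*} [Fintype ι]
    (hcard : Fintype.card ι ≤ n) (P : ι → Set ℝ) (hP : ∀ i, MeasurableSet (P i))
    (hPs : ∀ i, P i ⊆ Ioo 0 1) (hd : Pairwise (fun i j => Disjoint (P i) (P j)))
    (hPv : ∀ i, volume (P i) = ENNReal.ofReal (1 / n)) (c : ι → ℝ≥0∞) :
    X.N (fun t => ∑ j : Fin n, (Ico (((j : ℕ) : ℝ) / n) (((j : ℕ) + 1 : ℝ) / n)).indicator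
      (fun _ => ∑ i, (ENNReal.ofReal (((j : ℕ) / n : ℝ) ^ β) * ∫⁻ s in P i,
        (Ioo (((j : ℕ) + 1 : ℝ) / n) 1).indicator (fun s => ENNReal.ofReal (s ^ (-1 + α))) s)
          * c i) t)
      ≤ ENNReal.ofReal C * X.N (fun s => ∑ i, (P i).indicator (fun _ => c i) s) := by
  classical
  have hn' : (0 : ℝ) < n := by exact_mod_cast hn
  have hβ0 : 0 ≤ β := (le_max_left _ _).trans hβ
  let G : Fin n → ℝ → ℝ≥0∞ := fun j =>
    (Ioo (((j : ℕ) + 1 : ℝ) / n) 1).indicator (fun s => ENNReal.ofReal (s ^ (-1 + α)))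
  have hG : ∀ j, Measurable (G j) := fun j =>
    Measurable.indicator (by fun_prop) measurableSet_Ioo
  let M : Fin n → ι → ℝ≥0∞ := fun j i =>
    ENNReal.ofReal (((j : ℕ) / n : ℝ) ^ β) * ∫⁻ s in P i, G j s
  let J : Fin n → Set ℝ := fun j => Ico (((j : ℕ) : ℝ) / n) (((j : ℕ) + 1 : ℝ) / n)
  have hjn : ∀ j : Fin n, ((j : ℕ) + 1 : ℝ) / n ≤ 1 := by
    intro j
    rw [div_le_one hn']
    exact_mod_cast j.2
  have hJm : ∀ j, MeasurableSet (J j) := fun j => measurableSet_Ico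
  have hJv : ∀ j, μU (J j) = ENNReal.ofReal (1 / n) := by
    intro j
    have h1 : μU (J j) = μU (Ioo (((j : ℕ) : ℝ) / n) (((j : ℕ) + 1 : ℝ) / n)) := by
      unfold μU
      exact measure_congr Ioo_ae_eq_Ico.symm
    rw [h1, μU, Measure.restrict_apply measurableSet_Ioo, inter_eq_left.2, Real.volume_Ioo]
    · congr 1
      field_simp
      ring
    · exact Ioo_subset_Ioo (by positivity) (hjn j)
  have hJd : Pairwise (fun j k => Disjoint (J j) (J k)) := by
    have : ∀ j k : Fin n, j < k → Disjoint (J j) (J k) := by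
      intro j k hjk
      rw [Set.disjoint_left]
      rintro z ⟨_, h1⟩ ⟨h2, _⟩
      have h3 : ((j : ℕ) + 1 : ℝ) ≤ (k : ℕ) := by exact_mod_cast hjk
      have h4 : ((j : ℕ) + 1 : ℝ) / n ≤ (k : ℕ) / n := by gcongr
      linarith
    intro j k hjk
    rcases lt_or_gt_of_ne hjk with h | h
    · exact this _ _ h
    · exact (this _ _ h).symm
  have hrow : ∀ j, ∑ i, M j i ≤ ENNReal.ofReal C := by
    intro j
    simp only [M]
    rw [← Finset.mul_sum]
    have h1 : ∑ i, ∫⁻ s in P i, G j s ≤ ∫⁻ s, G j s := by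
      rw [← tsum_fintype (L := .unconditional _), ← lintegral_iUnion hP hd]
      exact setLIntegral_le_lintegral _ _
    have h2 : ∫⁻ s, G j s = ∫⁻ s in Ioo (((j : ℕ) + 1 : ℝ) / n) 1,
        ENNReal.ofReal (s ^ (-1 + α)) := lintegral_indicator measurableSet_Ioo _
    rw [h2] at h1
    refine (mul_le_mul_right h1 _).trans ?_
    refine (row_bound α β _ _ hα hβ (by positivity) ?_ (by positivity) (hjn j)).trans
      (ENNReal.ofReal_le_ofReal hC1)
    gcongr
    linarith
  have hcol : ∀ i, ∑ j, M j i ≤ ENNReal.ofReal C := by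
    intro i
    simp only [M]
    simp_rw [← lintegral_const_mul _ (hG _)]
    rw [← lintegral_finsetSum _ (fun j _ => (hG j).const_mul _)]
    calc _ ≤ ∫⁻ s in P i, ENNReal.ofReal (n / (β + 1)) :=
          setLIntegral_mono measurable_const fun s hs => col_point α β hβ n hn s (hPs i hs)
      _ = ENNReal.ofReal (1 / (β + 1)) := by
          rw [setLIntegral_const, hPv, ← ENNReal.ofReal_mul (by positivity)]
          congr 1
          field_simp
      _ ≤ _ := ENNReal.ofReal_le_ofReal hC2
  have hMfin : ∀ j i, M j i ≠ ∞ := fun j i =>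
    (((Finset.single_le_sum (fun _ _ => zero_le) (Finset.mem_univ i)).trans
      (hrow j)).trans_lt ENNReal.ofReal_lt_top).ne
  obtain ⟨w, hw1, e, he, hMe⟩ := birk hcard (fun j i => (M j i).toReal / C)
    (fun j i => by positivity)
    (fun j => by
      rw [← Finset.sum_div, div_le_one hC, ← ENNReal.toReal_sum fun i _ => hMfin j i]
      exact ENNReal.toReal_le_of_le_ofReal hC.le (hrow j))
    (fun i => by
      rw [← Finset.sum_div, div_le_one hC, ← ENNReal.toReal_sum fun j _ => hMfin j i]
      exact ENNReal.toReal_le_of_le_ofReal hC.le (hcol i))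
  have hMe' : ∀ j i, M j i ≤ ∑ σ, ((C.toNNReal * w σ : ℝ≥0) : ℝ≥0∞) *
      if e σ i = j then 1 else 0 := by
    intro j i
    have h := hMe j i
    rw [div_le_iff₀ hC, Finset.sum_mul] at h
    rw [← ENNReal.ofReal_toReal (hMfin j i)]
    refine (ENNReal.ofReal_le_ofReal h).trans ?_
    rw [ENNReal.ofReal_sum_of_nonneg (fun σ _ => by positivity)]
    refine Finset.sum_le_sum fun σ _ => le_of_eq ?_
    split_ifs
    · rw [mul_one, mul_one, mul_comm, ENNReal.ofReal_mul hC.le]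
      simp [ENNReal.ofReal]
    · simp
  let Q : Equiv.Perm (Fin n) → ℝ → ℝ≥0∞ := fun σ t =>
    ∑ i, (J (e σ i)).indicator (fun _ => c i) t
  have hQ : ∀ σ, Measurable (Q σ) := fun σ =>
    Finset.measurable_fun_sum _ fun i _ => measurable_const.indicator (hJm _)
  have hfm : Measurable (fun s => ∑ i, (P i).indicator (fun _ => c i) s) :=
    Finset.measurable_fun_sum _ fun i _ => measurable_const.indicator (hP _)
  have hQN : ∀ σ, X.N (Q σ) = X.N (fun s => ∑ i, (P i).indicator (fun _ => c i) s) := by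
    intro σ
    refine X.rearr_invariant _ _ (hQ σ) hfm fun l => ?_
    rw [meas_sum_ind (fun i => J (e σ i)) c (fun i => hJm _)
      (fun i k hik => hJd ((he σ).ne hik)) (ENNReal.ofReal (1 / n)) l (fun i => hJv _),
      meas_sum_ind P c hP hd (ENNReal.ofReal (1 / n)) l (fun i => ?_)]
    rw [μU, Measure.restrict_apply (hP i), inter_eq_left.2 (hPs i), hPv]
  calc X.N (fun t => ∑ j, (J j).indicator (fun _ => ∑ i, M j i * c i) t)
      ≤ X.N (fun t => ∑ σ, ((C.toNNReal * w σ : ℝ≥0) : ℝ≥0∞) * Q σ t) := by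
        refine X.mono _ _ ?_ ?_ (Eventually.of_forall fun t => ?_)
        · exact Finset.measurable_fun_sum _ fun i _ => measurable_const.indicator (hJm _)
        · exact Finset.measurable_fun_sum _ fun σ _ => (hQ σ).const_mul _
        · have h1 : ∀ σ, Q σ t = ∑ j, ∑ i, (if e σ i = j then 1 else 0) *
              (J j).indicator (fun _ => c i) t := by
            intro σ
            rw [Finset.sum_comm]
            simp [Q]
          simp_rw [h1, Finset.mul_sum]
          rw [Finset.sum_comm]
          refine Finset.sum_le_sum fun j _ => ?_
          rw [Finset.sum_comm]
          by_cases ht : t ∈ J j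
          · simp only [Set.indicator_of_mem ht]
            refine Finset.sum_le_sum fun i _ => ?_
            refine (mul_le_mul_left (hMe' j i) _).trans ?_
            rw [Finset.sum_mul]
            simp_rw [mul_assoc]
            exact le_rfl
          · simp only [Set.indicator_of_notMem ht]
            exact zero_le
    _ ≤ ∑ σ, X.N (fun t => ((C.toNNReal * w σ : ℝ≥0) : ℝ≥0∞) * Q σ t) :=
        ri_sum X _ _ fun σ => (hQ σ).const_mul _
    _ = ∑ σ, ((C.toNNReal * w σ : ℝ≥0) : ℝ≥0∞) *
          X.N (fun s => ∑ i, (P i).indicator (fun _ => c i) s) := by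
        refine Finset.sum_congr rfl fun σ _ => ?_
        rw [X.smul_eq _ _ (hQ σ), hQN]
    _ = _ := by
        rw [← Finset.sum_mul]
        congr 1
        rw [← ENNReal.ofNNReal_finsetSum, ← Finset.mul_sum, hw1, mul_one]
        rfl

lemma T_meas (α β : ℝ) (f : ℝ → ℝ≥0∞) :
    Measurable (fun t : ℝ => ENNReal.ofReal (t ^ β) *
        ∫⁻ s in Set.Ioo t 1, f s * ENNReal.ofReal (s ^ (-1 + α))) := by
  refine Measurable.mul (by fun_prop) (Antitone.measurable fun a b hab => ?_)
  exact lintegral_mono_set (Ioo_subset_Ioo_left hab)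

lemma simple_case (X : RINorm μU) (α β : ℝ) (hα : α ≠ 0) (hβ : max 0 (-α) ≤ β) (C : ℝ) (hC : 0 < C)
    (hC1 : 1 / |α| ≤ C) (hC2 : 1 / (β + 1) ≤ C) (φ : SimpleFunc ℝ ℝ≥0∞) :
    X.N (fun t => ENNReal.ofReal (t ^ β) *
        ∫⁻ s in Set.Ioo t 1, φ s * ENNReal.ofReal (s ^ (-1 + α)))
      ≤ ENNReal.ofReal C * X.N φ := by
  classical
  let E : ℝ≥0∞ → Set ℝ := fun c => φ ⁻¹' {c} ∩ Ioo 0 1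
  have hE : ∀ c, MeasurableSet (E c) := fun c => (φ.measurableSet_fiber c).inter measurableSet_Ioo
  have hE1 : ∀ c, E c ⊆ Ioo 0 1 := fun c => inter_subset_right
  choose P hPm hPE hPd hPv hPae using fun c => split_set (E c) (hE c) (hE1 c)
  let ι : ℕ → Type := fun n => Σ c : φ.range, Fin ⌊(n : ℝ) * volume.real (E c)⌋₊
  let Pn : (n : ℕ) → ι n → Set ℝ := fun n i => P i.1 n i.2
  let cn : (n : ℕ) → ι n → ℝ≥0∞ := fun n i => i.1
  have hEd : ∀ c d, c ≠ d → Disjoint (E c) (E d) := by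
    intro c d hcd
    rw [Set.disjoint_left]
    rintro z ⟨h1, _⟩ ⟨h2, _⟩
    exact hcd (h1.symm.trans h2)
  have hdis : ∀ n, Pairwise (fun i j => Disjoint (Pn n i) (Pn n j)) := by
    rintro n ⟨c, k⟩ ⟨d, l⟩ hne
    by_cases hcd : c = d
    · subst hcd
      refine hPd _ _ _ _ fun h => hne ?_
      have h' : k = l := Fin.ext h
      rw [h']
    · exact (hEd c d (fun h => hcd (Subtype.ext h))).mono (hPE _ _ _) (hPE _ _ _)
  have hcard : ∀ n, Fintype.card (ι n) ≤ n := by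
    intro n
    have h1 : ∑ c : φ.range, volume.real (E c) ≤ 1 := by
      have h2 : ∑ c : φ.range, volume.real (E c) = volume.real (⋃ c ∈ (Finset.univ : Finset φ.range), E c) := by
        have hfin : ∀ c, volume (E c) ≠ ∞ := fun c =>
          ((measure_mono (hE1 c)).trans_lt (by simp)).ne
        exact (measureReal_biUnion_finset (μ := volume) (f := fun c : φ.range => E c)
          (fun c _ d _ hcd => hEd c d (fun h => hcd (Subtype.ext h)))
          (fun c _ => hE c)
          (fun c _ => hfin c)).symm
      rw [h2]
      refine (measureReal_mono (μ := volume) (s₂ := Ioo (0:ℝ) 1) (iUnion₂_subset fun (c : φ.range) _ => hE1 c) (by simp)).trans ?_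
      simp
    simp only [ι, Fintype.card_sigma, Fintype.card_fin]
    have h3 : ((∑ c : φ.range, ⌊(n : ℝ) * volume.real (E c)⌋₊ : ℕ) : ℝ) ≤ n := by
      push_cast
      calc _ ≤ ∑ c : φ.range, (n : ℝ) * volume.real (E c) :=
            Finset.sum_le_sum fun c _ => Nat.floor_le (by positivity)
        _ = n * ∑ c : φ.range, volume.real (E c) := by rw [Finset.mul_sum]
        _ ≤ n * 1 := by gcongr
        _ = n := mul_one _
    exact_mod_cast h3
  let fn : ℕ → ℝ → ℝ≥0∞ := fun n s => ∑ i, (Pn n i).indicator (fun _ => cn n i) s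
  have hfnm : ∀ n, Measurable (fn n) := fun n =>
    Finset.measurable_fun_sum _ fun i _ => measurable_const.indicator (hPm _ _ _)
  have hfnval : ∀ n i s, s ∈ Pn n i → fn n s = φ s := by
    intro n i s hs
    have : φ s = cn n i := (hPE _ _ _ hs).1
    simp only [fn]
    rw [Finset.sum_eq_single i, Set.indicator_of_mem hs, this]
    · intro k _ hk
      exact Set.indicator_of_notMem (fun h => Set.disjoint_left.1 (hdis n hk) h hs) _
    · simp
  have hfnle : ∀ n s, fn n s ≤ φ s := by
    intro n s
    by_cases h : ∃ i, s ∈ Pn n i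
    · obtain ⟨i, hi⟩ := h
      exact (hfnval n i s hi).le
    · push Not at h
      simp [fn, h]
  have hfnae : ∀ᵐ s, s ∈ Ioo (0:ℝ) 1 → ∀ᶠ n in atTop, fn n s = φ s := by
    have : ∀ᵐ s, ∀ c : φ.range, s ∈ E c → ∀ᶠ n : ℕ in atTop,
        ∃ k < ⌊(n : ℝ) * volume.real (E c)⌋₊, s ∈ P c n k := ae_all_iff.2 fun c => hPae c
    filter_upwards [this] with s hs hs1
    have := hs ⟨φ s, φ.mem_range_self s⟩ ⟨rfl, hs1⟩
    filter_upwards [this] with n hn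
    obtain ⟨k, hk, hsk⟩ := hn
    exact hfnval n ⟨⟨φ s, φ.mem_range_self s⟩, ⟨k, hk⟩⟩ s hsk
  let G : ℝ → ℝ → ℝ≥0∞ := fun b =>
    (Ioo b 1).indicator (fun s => ENNReal.ofReal (s ^ (-1 + α)))
  have hG : ∀ b, Measurable (G b) := fun b =>
    Measurable.indicator (by fun_prop) measurableSet_Ioo
  let h : ℕ → ℝ → ℝ≥0∞ := fun n t =>
    ∑ j : Fin n, (Ico (((j : ℕ) : ℝ) / n) (((j : ℕ) + 1 : ℝ) / n)).indicator
      (fun _ => ∑ i, (ENNReal.ofReal (((j : ℕ) / n : ℝ) ^ β) * ∫⁻ s in Pn n i,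
        G (((j : ℕ) + 1 : ℝ) / n) s) * cn n i) t
  refine ri_liminf X h _ (fun n => ?_) (T_meas α β φ) _ ?_ ?_
  · exact Finset.measurable_fun_sum _ fun i _ => measurable_const.indicator measurableSet_Ico
  · filter_upwards [eventually_gt_atTop 0] with n hn
    refine (core X α β hα hβ C hC hC1 hC2 n hn (hcard n) (Pn n) (fun i => hPm _ _ _)
      (fun i => (hPE _ _ _).trans (hE1 _)) (hdis n) (fun i => hPv _ _ _ hn i.2.2) (cn n)).trans ?_
    gcongr
    exact X.mono _ _ (hfnm n) φ.measurable (Eventually.of_forall (hfnle n))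
  · have hmem : ∀ᵐ t ∂μU, t ∈ Ioo (0:ℝ) 1 := ae_restrict_mem measurableSet_Ioo
    filter_upwards [hmem] with t ht
    have ht0 := ht.1
    let g : ℕ → ℝ → ℝ≥0∞ := fun n s =>
      ENNReal.ofReal (((⌊t * n⌋₊ : ℕ) / n : ℝ) ^ β) * (G ((⌊t * n⌋₊ + 1 : ℝ) / n) s * fn n s)
    have hgm : ∀ n, Measurable (g n) := fun n => ((hG _).mul (hfnm n)).const_mul _
    have hgh : ∀ᶠ n in atTop, ∫⁻ s, g n s ≤ h n t := by
      filter_upwards [eventually_gt_atTop 0] with n hn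
      have hn' : (0 : ℝ) < n := by exact_mod_cast hn
      have hlt : ⌊t * n⌋₊ < n := by
        rw [Nat.floor_lt (by positivity)]
        nlinarith [ht.2]
      have hmemJ : t ∈ Ico ((⌊t * n⌋₊ : ℝ) / n) ((⌊t * n⌋₊ + 1 : ℝ) / n) := by
        constructor
        · rw [div_le_iff₀ hn']
          exact Nat.floor_le (by positivity)
        · rw [lt_div_iff₀ hn']
          exact Nat.lt_floor_add_one _
      refine le_trans ?_ (Finset.single_le_sum (fun _ _ => zero_le)
        (Finset.mem_univ (⟨⌊t * n⌋₊, hlt⟩ : Fin n)))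
      simp only []
      rw [Set.indicator_of_mem hmemJ]
      simp only [g, fn]
      rw [lintegral_const_mul' _ _ ENNReal.ofReal_ne_top]
      simp_rw [Finset.mul_sum]
      rw [lintegral_finsetSum]
      swap
      · intro i _
        exact (hG _).mul (measurable_const.indicator (hPm _ _ _))
      rw [Finset.mul_sum]
      refine Finset.sum_le_sum fun i _ => ?_
      rw [mul_assoc]
      gcongr
      rw [← lintegral_mul_const _ (hG _), ← lintegral_indicator (hPm _ _ _)]
      refine lintegral_mono fun s => ?_
      by_cases hs : s ∈ Pn n i
      · rw [Set.indicator_of_mem hs, Set.indicator_of_mem (s := P _ _ _) hs]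
      · rw [Set.indicator_of_notMem hs]
        simp
    refine le_trans ?_ (liminf_le_liminf hgh)
    refine le_trans ?_ (lintegral_liminf_le hgm)
    rw [← lintegral_indicator measurableSet_Ioo, ← lintegral_const_mul']
    swap
    · exact ENNReal.ofReal_ne_top
    refine lintegral_mono_ae ?_
    filter_upwards [hfnae] with s hs
    by_cases hst : s ∈ Ioo t 1
    · rw [Set.indicator_of_mem hst]
      have hlim1 : Tendsto (fun n : ℕ => ((⌊t * n⌋₊ : ℕ) / n : ℝ)) atTop (𝓝 t) :=
        (tendsto_nat_floor_mul_div_atTop ht0.le).comp tendsto_natCast_atTop_atTop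
      have hlim2 : Tendsto (fun n : ℕ => ((⌊t * n⌋₊ + 1 : ℝ) / n)) atTop (𝓝 t) := by
        have := hlim1.add tendsto_one_div_atTop_nhds_zero_nat
        simp only [add_zero] at this
        refine this.congr fun n => ?_
        rw [add_div]
      have hlim3 : Tendsto (fun n : ℕ => ENNReal.ofReal (((⌊t * n⌋₊ : ℕ) / n : ℝ) ^ β) *
          (φ s * ENNReal.ofReal (s ^ (-1 + α)))) atTop
          (𝓝 (ENNReal.ofReal (t ^ β) * (φ s * ENNReal.ofReal (s ^ (-1 + α))))) := by
        refine ENNReal.Tendsto.mul_const ?_ (Or.inl ?_)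
        · exact ENNReal.tendsto_ofReal (hlim1.rpow_const (Or.inl ht0.ne'))
        · simpa using Real.rpow_pos_of_pos ht0 β
      rw [← hlim3.liminf_eq]
      refine liminf_le_liminf ?_
      filter_upwards [hs ⟨ht0.trans hst.1, hst.2⟩, hlim2.eventually_lt_const hst.1] with n h1 h2
      simp only [g, G]
      have h3 : s ∈ Ioo ((⌊t * n⌋₊ + 1 : ℝ) / n) 1 := ⟨h2, hst.2⟩
      rw [h1, Set.indicator_of_mem h3, mul_comm (φ s)]
    · rw [Set.indicator_of_notMem hst]
      simp

/-- boundedness of the operator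
`T_{α,β} f (t) = t^β ∫_t^1 |f(s)| s^{-1+α} ds` on every r.i. norm over `(0,1)`,
with operator norm at most `max {1/|α|, 1/(β+1)}`. -/
theorem Tab_bounded_on_ri (α β : ℝ) (hα : α ≠ 0) (hβ : max 0 (-α) ≤ β)
    (X : RINorm μU) (f : ℝ → ℝ≥0∞) (hf : Measurable f) :
    X.N (fun t => ENNReal.ofReal (t ^ β) *
        ∫⁻ s in Set.Ioo t 1, f s * ENNReal.ofReal (s ^ (-1 + α)))
      ≤ ENNReal.ofReal (max (1 / |α|) (1 / (β + 1))) * X.N f := by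
  have hC : 0 < max (1 / |α|) (1 / (β + 1)) :=
    lt_max_of_lt_left (one_div_pos.2 (abs_pos.2 hα))
  refine ri_liminf X (fun n t => ENNReal.ofReal (t ^ β) *
        ∫⁻ s in Set.Ioo t 1, SimpleFunc.eapprox f n s * ENNReal.ofReal (s ^ (-1 + α))) _
    (fun n => T_meas α β _) (T_meas α β f) _ (Eventually.of_forall fun n => ?_)
    (Eventually.of_forall fun t => ?_)
  · refine (simple_case X α β hα hβ _ hC (le_max_left _ _) (le_max_right _ _) _).trans ?_
    gcongr
    refine X.mono _ _ (SimpleFunc.measurable _) hf (Eventually.of_forall fun s => ?_)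
    rw [← SimpleFunc.iSup_eapprox_apply hf s]
    exact le_iSup (fun n => SimpleFunc.eapprox f n s) n
  · have hlim : Tendsto (fun n => ∫⁻ s in Set.Ioo t 1,
        SimpleFunc.eapprox f n s * ENNReal.ofReal (s ^ (-1 + α))) atTop
        (𝓝 (∫⁻ s in Set.Ioo t 1, f s * ENNReal.ofReal (s ^ (-1 + α)))) := by
      refine lintegral_tendsto_of_tendsto_of_monotone (fun n => ?_) ?_ ?_
      · exact ((SimpleFunc.measurable _).mul (by fun_prop)).aemeasurable
      · refine Eventually.of_forall fun s a b hab => ?_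
        exact mul_le_mul_left (SimpleFunc.monotone_eapprox f hab s) _
      · refine Eventually.of_forall fun s => ?_
        refine ENNReal.Tendsto.mul_const ?_ (Or.inr ENNReal.ofReal_ne_top)
        have := tendsto_atTop_iSup (f := fun n => SimpleFunc.eapprox f n s)
          (fun a b hab => SimpleFunc.monotone_eapprox f hab s)
        rwa [SimpleFunc.iSup_eapprox_apply hf s] at this
    exact (ENNReal.Tendsto.const_mul hlim (Or.inr ENNReal.ofReal_ne_top)).liminf_eq.ge

end
end

section
/- Let n ∈ ℕ, n ≥ 2. Let ‖·‖_X̄ and ‖·‖_Ȳ be rearrangement-invariant function norms over (0,∞), and for measurable v : ℝⁿ → ℝ set ‖v‖_{X(ℝⁿ)} := ‖v^*‖_X̄ and ‖v‖_{Y(ℝⁿ)} := ‖v^*‖_Ȳ, where v^* is the nonincreasing rearrangement of v with respect to Lebesgue measure on ℝⁿ. There is a constant C > 0, depending only on n, such that for every radially symmetric weakly differentiable function u : ℝⁿ → ℝ with weak gradient ∇u, and every R > 0: ‖u χ_{ℝⁿ∖B_R}‖_{Y(ℝⁿ)} ≤ C ( sup_{‖f‖_X̄ ≤ 1} ‖f^*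 χ_{(R^{n−1},∞)}‖_Ȳ ) ( ‖u‖_{X(ℝⁿ)} + ‖|∇u|‖_{X(ℝⁿ)} ), where B_R is the open ball of radius R centered at the origin and the supremum is over measurable f on (0,∞) with ‖f‖_X̄ ≤ 1. -/
open MeasureTheory Set Filter Topology
open scoped ENNReal NNReal

noncomputable section

/-- Lebesgue measure on `(0,∞)`. -/
def μI : Measure ℝ := volume.restrict (Set.Ioi (0 : ℝ))

/-- The fundamental function of an r.i. norm over `(0,∞)`: `φ_X(t) = ‖χ_(0,t)‖_X`. -/
def fund (X : RINorm μI) (t : ℝ) : ℝ≥0∞ := X.N ((Set.Ioo (0 : ℝ) t).indicator fun _ => 1)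


/-- The nonincreasing rearrangement of a real-valued function. -/
def rearrR {α : Type*} [MeasurableSpace α] (μ : Measure α) (u : α → ℝ) (t : ℝ) : ℝ≥0∞ :=
  rearr μ (fun x => ENNReal.ofReal |u x|) t

abbrev Euc (n : ℕ) := EuclideanSpace ℝ (Fin n)

/-- `u` is weakly differentiable on `ℝⁿ` with weak gradient `Du`. -/
def HasWeakGradient {n : ℕ} (u : Euc n → ℝ) (Du : Fin n → Euc n → ℝ) : Prop :=
  LocallyIntegrable u volume ∧ (∀ i, LocallyIntegrable (Du i) volume) ∧
    ∀ (i : Fin n) (φ : Euc n → ℝ), ContDiff ℝ (⊤ : ℕ∞) φ → HasCompactSupport φ →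
      ∫ x, u x * fderiv ℝ φ x (EuclideanSpace.single i 1) = -∫ x, Du i x * φ x

section aux_rearr

variable {α : Type*} [MeasurableSpace α]

lemma lt_rearr_iff (μ : Measure α) (f : α → ℝ≥0∞) (t : ℝ) (l : ℝ≥0∞) :
    l < rearr μ f t ↔ ENNReal.ofReal t < μ {x | l < f x} := by
  constructor
  · intro h
    by_contra hc
    push Not at hc
    exact absurd (sInf_le (show l ∈ {l : ℝ≥0∞ | μ {x | l < f x} ≤ ENNReal.ofReal t} from hc))
      (not_le.mpr h)
  · intro h
    have hl : l ≠ ∞ := by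
      rintro rfl
      simp at h
    obtain ⟨v, hv1, hv2, hv3⟩ := exists_seq_strictAnti_tendsto' (show l < ∞ from hl.lt_top)
    have hU : {x | l < f x} = ⋃ k, {x | v k < f x} := by
      ext x
      simp only [mem_ofPred_eq, mem_iUnion]
      constructor
      · intro hx
        exact ((hv3.eventually (gt_mem_nhds hx)).exists)
      · rintro ⟨k, hk⟩
        exact (hv2 k).1.trans hk
    have hmono : Monotone fun k => {x | v k < f x} := by
      intro a b hab x hx
      exact lt_of_le_of_lt (hv1.antitone hab) hx
    rw [hU, hmono.measure_iUnion] at h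
    obtain ⟨k, hk⟩ := lt_iSup_iff.mp h
    refine lt_of_lt_of_le (hv2 k).1 (le_sInf ?_)
    intro m hm
    by_contra hc
    push Not at hc
    have : μ {x | v k < f x} ≤ μ {x | m < f x} := measure_mono fun x hx => hc.trans hx
    exact absurd (hk.trans_le (this.trans hm)) (lt_irrefl _)

lemma rearr_antitone (μ : Measure α) (f : α → ℝ≥0∞) : Antitone (rearr μ f) := by
  intro s t hst
  refine le_of_forall_lt fun l hl => ?_
  rw [lt_rearr_iff] at hl ⊢
  exact (ENNReal.ofReal_le_ofReal hst).trans_lt hl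

lemma rearr_measurable (μ : Measure α) (f : α → ℝ≥0∞) : Measurable (rearr μ f) :=
  (rearr_antitone μ f).measurable

lemma rearr_mono (μ : Measure α) {f g : α → ℝ≥0∞} (h : ∀ᵐ x ∂μ, f x ≤ g x) (t : ℝ) :
    rearr μ f t ≤ rearr μ g t := by
  refine le_of_forall_lt fun l hl => ?_
  rw [lt_rearr_iff] at hl ⊢
  refine hl.trans_le (measure_mono_ae ?_)
  filter_upwards [h] with x hx hlx
  exact lt_of_lt_of_le (show l < f x from hlx) hx

lemma rearr_le_of_ae (μ : Measure α) {f : α → ℝ≥0∞} {B : ℝ≥0∞} (h : ∀ᵐ x ∂μ, f x ≤ B) (t : ℝ) :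
    rearr μ f t ≤ B := by
  refine sInf_le ?_
  have : μ {x | B < f x} = 0 := by
    rw [ae_iff] at h
    simpa using h
  simp [this]

lemma muI_lt (m : ℝ≥0∞) : μI {s : ℝ | ENNReal.ofReal s < m} = m := by
  rw [μI, Measure.restrict_apply' measurableSet_Ioi]
  by_cases hm : m = ∞
  · subst hm
    simp
  · have : {s : ℝ | ENNReal.ofReal s < m} ∩ Ioi 0 = Ioo 0 m.toReal := by
      ext s
      simp only [mem_inter_iff, mem_ofPred_eq, mem_Ioi, mem_Ioo]
      constructor
      · rintro ⟨h1, h2⟩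
        refine ⟨h2, ?_⟩
        exact (ENNReal.ofReal_lt_iff_lt_toReal h2.le hm).mp h1
      · rintro ⟨h1, h2⟩
        exact ⟨(ENNReal.ofReal_lt_iff_lt_toReal h1.le hm).mpr h2, h1⟩
    rw [this, Real.volume_Ioo, sub_zero, ENNReal.ofReal_toReal hm]

lemma muI_rearr (μ : Measure α) (f : α → ℝ≥0∞) (l : ℝ≥0∞) :
    μI {s | l < rearr μ f s} = μ {x | l < f x} := by
  simp_rw [lt_rearr_iff]
  exact muI_lt _

lemma rearr_rearr (μ : Measure α) (f : α → ℝ≥0∞) (t : ℝ) :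
    rearr μI (rearr μ f) t = rearr μ f t := by
  refine eq_of_forall_lt_iff fun l => ?_
  rw [lt_rearr_iff, lt_rearr_iff, muI_rearr]

lemma rearr_smul (μ : Measure α) (f : α → ℝ≥0∞) (c : ℝ≥0) (hc : c ≠ 0) (t : ℝ) :
    rearr μ (fun x => (c : ℝ≥0∞) * f x) t = c * rearr μ f t := by
  have hc' : (c : ℝ≥0∞) ≠ 0 := by simpa using hc
  have key : ∀ l y : ℝ≥0∞, l < c * y ↔ l / c < y := by
    intro l y
    rw [ENNReal.div_lt_iff (Or.inl hc') (Or.inl ENNReal.coe_ne_top), mul_comm]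
  refine eq_of_forall_lt_iff fun l => ?_
  rw [lt_rearr_iff, key, lt_rearr_iff]
  simp_rw [key]

lemma layer_cake_ennreal (F : ℝ → ℝ≥0∞) (hF : Measurable F) (ν : Measure ℝ) [SFinite ν] :
    ∫⁻ t, F t ∂ν = ∫⁻ l in Ioi (0:ℝ), ν {t | ENNReal.ofReal l < F t} := by
  have hms : MeasurableSet {p : ℝ × ℝ | ENNReal.ofReal p.2 < F p.1} :=
    measurableSet_lt (by fun_prop) (by fun_prop)
  have h1 : ∀ t, F t = ∫⁻ l in Ioi (0:ℝ),
      ({p : ℝ × ℝ | ENNReal.ofReal p.2 < F p.1}.indicator (fun _ => (1:ℝ≥0∞))) (t, l) := by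
    intro t
    have hm2 : MeasurableSet {l : ℝ | ENNReal.ofReal l < F t} :=
      measurableSet_lt (by fun_prop) (by fun_prop)
    have : ∀ l : ℝ, ({p : ℝ × ℝ | ENNReal.ofReal p.2 < F p.1}.indicator
        (fun _ => (1:ℝ≥0∞))) (t, l) = {l : ℝ | ENNReal.ofReal l < F t}.indicator (fun _ => 1) l := by
      intro l
      simp [indicator]
    simp_rw [this]
    rw [lintegral_indicator_const hm2, one_mul]
    exact (muI_lt (F t)).symm
  rw [lintegral_congr h1, lintegral_lintegral_swap]
  · refine lintegral_congr fun l => ?_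
    have hm2 : MeasurableSet {t : ℝ | ENNReal.ofReal l < F t} :=
      measurableSet_lt (by fun_prop) (by fun_prop)
    have : ∀ t : ℝ, ({p : ℝ × ℝ | ENNReal.ofReal p.2 < F p.1}.indicator
        (fun _ => (1:ℝ≥0∞))) (t, l) = {t : ℝ | ENNReal.ofReal l < F t}.indicator (fun _ => 1) t := by
      intro l
      simp [indicator]
    simp_rw [this]
    rw [lintegral_indicator_const hm2, one_mul]
  · exact (measurable_const.indicator hms).aemeasurable

lemma hardy_littlewood (μ : Measure α) (w : α → ℝ) (hw0 : ∀ x, 0 ≤ w x) (hw : AEMeasurable w μ)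
    (A : Set α) (T : ℝ) (hA : μ A = ENNReal.ofReal T) :
    ∫⁻ x in A, ENNReal.ofReal (w x) ∂μ ≤
      ∫⁻ t in Ioo 0 T, rearr μ (fun x => ENNReal.ofReal (w x)) t := by
  rw [lintegral_eq_lintegral_meas_lt _ (ae_of_all _ hw0) hw.restrict,
    layer_cake_ennreal _ (rearr_measurable _ _)]
  refine setLIntegral_mono' measurableSet_Ioi fun l hl => ?_
  simp_rw [lt_rearr_iff]
  have hlw : {a | l < w a} = {x | ENNReal.ofReal l < ENNReal.ofReal (w x)} := by
    ext x
    simp only [mem_ofPred_eq]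
    rw [ENNReal.ofReal_lt_ofReal_iff_of_nonneg (le_of_lt hl)]
  set m := μ {x | ENNReal.ofReal l < ENNReal.ofReal (w x)} with hm
  have h1 : (μ.restrict A) {a | l < w a} ≤ min m (ENNReal.ofReal T) := by
    refine le_min ?_ ?_
    · rw [hm, ← hlw]
      exact Measure.restrict_apply_le _ _
    · rw [← hA]
      exact (measure_mono (subset_univ _)).trans (by simp)
  refine h1.trans ?_
  rw [Measure.restrict_apply' measurableSet_Ioo]
  rw [← muI_lt (min m (ENNReal.ofReal T)), μI, Measure.restrict_apply' measurableSet_Ioi]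
  refine measure_mono ?_
  rintro s ⟨hs1, hs2⟩
  simp only [mem_ofPred_eq, lt_min_iff] at hs1
  refine ⟨hs1.1, hs2, ?_⟩
  exact (ENNReal.ofReal_lt_ofReal_iff_of_nonneg (le_of_lt hs2)).mp hs1.2

end aux_rearr

section aux_avg

/-- step intervals -/
def stepI (δ : ℝ) (k : ℕ) : Set ℝ := Ioc ((k:ℝ) * δ) (((k:ℝ) + 1) * δ)

lemma stepI_meas (δ : ℝ) (k : ℕ) : MeasurableSet (stepI δ k) := measurableSet_Ioc

lemma stepI_muI {δ : ℝ} (hδ : 0 < δ) (k : ℕ) : μI (stepI δ k) = ENNReal.ofReal δ := by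
  have : stepI δ k ⊆ Ioi 0 := by
    intro x hx
    have : (0:ℝ) ≤ k * δ := by positivity
    exact lt_of_le_of_lt this hx.1
  rw [μI, Measure.restrict_apply' measurableSet_Ioi, inter_eq_left.mpr this, stepI,
    Real.volume_Ioc]
  congr 1
  ring

lemma stepI_disj {δ : ℝ} (hδ : 0 < δ) {j k : ℕ} {x : ℝ} (h1 : x ∈ stepI δ j) (h2 : x ∈ stepI δ k) :
    j = k := by
  have a1 : (j:ℝ) < k + 1 := by
    have := h1.1.trans_le h2.2
    exact lt_of_mul_lt_mul_right this hδ.le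
  have a2 : (k:ℝ) < j + 1 := by
    have := h2.1.trans_le h1.2
    exact lt_of_mul_lt_mul_right this hδ.le
  have b1 : j < k + 1 := by exact_mod_cast a1
  have b2 : k < j + 1 := by exact_mod_cast a2
  omega

lemma stepI_cover {δ : ℝ} (hδ : 0 < δ) {N : ℕ} {x : ℝ} (h0 : 0 < x) (h1 : x ≤ N * δ) :
    ∃ k : Fin N, x ∈ stepI δ k := by
  have hx : 0 < x / δ := div_pos h0 hδ
  have hc : 0 < ⌈x / δ⌉₊ := Nat.ceil_pos.mpr hx
  have hN : ⌈x / δ⌉₊ ≤ N := Nat.ceil_le.mpr (by rwa [div_le_iff₀ hδ])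
  obtain ⟨m, hm⟩ : ∃ m, ⌈x / δ⌉₊ = m + 1 := ⟨⌈x / δ⌉₊ - 1, by omega⟩
  have := (Nat.ceil_eq_iff (by omega)).mp hm
  refine ⟨⟨m, by omega⟩, ?_, ?_⟩
  · have := this.1
    simp only [Nat.add_sub_cancel] at this
    rwa [lt_div_iff₀ hδ] at this
  · have := this.2
    push_cast at this
    rwa [div_le_iff₀ hδ] at this

/-- step function -/
def stepF (δ : ℝ) {N : ℕ} (b : Fin N → ℝ≥0∞) (x : ℝ) : ℝ≥0∞ :=
  ∑ k : Fin N, (stepI δ k).indicator (fun _ => b k) x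

lemma stepF_meas (δ : ℝ) {N : ℕ} (b : Fin N → ℝ≥0∞) : Measurable (stepF δ b) := by
  unfold stepF
  exact Finset.measurable_sum _ fun k _ => measurable_const.indicator (stepI_meas _ _)

lemma stepF_eq {δ : ℝ} (hδ : 0 < δ) {N : ℕ} (b : Fin N → ℝ≥0∞) {k : Fin N} {x : ℝ}
    (hx : x ∈ stepI δ k) : stepF δ b x = b k := by
  unfold stepF
  rw [Finset.sum_eq_single k]
  · simp [hx]
  · intro j _ hj
    refine indicator_of_notMem (fun h => hj ?_) _
    exact Fin.ext (stepI_disj hδ h hx)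
  · simp

lemma stepF_dist {δ : ℝ} (hδ : 0 < δ) {N : ℕ} (b : Fin N → ℝ≥0∞) (l : ℝ≥0∞) :
    μI {x | l < stepF δ b x} = ∑ k : Fin N, if l < b k then ENNReal.ofReal δ else 0 := by
  have : {x | l < stepF δ b x} = ⋃ k : Fin N, {x | x ∈ stepI δ k ∧ l < b k} := by
    ext x
    simp only [mem_ofPred_eq, mem_iUnion]
    constructor
    · intro h
      have : ∃ k : Fin N, x ∈ stepI δ k := by
        by_contra hc
        push Not at hc
        have : stepF δ b x = 0 := Finset.sum_eq_zero fun k _ => indicator_of_notMem (hc k) _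
        simp [this] at h
      obtain ⟨k, hk⟩ := this
      exact ⟨k, hk, by rwa [stepF_eq hδ b hk] at h⟩
    · rintro ⟨k, hk, h⟩
      rwa [stepF_eq hδ b hk]
  rw [this, measure_iUnion, tsum_fintype]
  · refine Finset.sum_congr rfl fun k _ => ?_
    by_cases h : l < b k
    · simp only [h, and_true, if_true]
      exact stepI_muI hδ k
    · simp [h]
  · intro j k hjk
    refine Set.disjoint_left.mpr ?_
    rintro x ⟨h1, _⟩ ⟨h2, _⟩
    exact hjk (Fin.ext (stepI_disj hδ h1 h2))
  · intro k
    by_cases h : l < b k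
    · simp only [h, and_true]
      exact stepI_meas _ _
    · simp [h]

lemma RINorm.sum_le (X : RINorm μI) {ι : Type*} (s : Finset ι) (f : ι → ℝ → ℝ≥0∞)
    (hf : ∀ i, Measurable (f i)) :
    X.N (fun x => ∑ i ∈ s, f i x) ≤ ∑ i ∈ s, X.N (f i) := by
  classical
  induction s using Finset.induction_on with
  | empty =>
    simp only [Finset.sum_empty]
    exact le_of_eq ((X.eq_zero_iff _ measurable_const).mpr (by rfl))
  | insert a s ha ih =>
    simp only [Finset.sum_insert ha]
    exact (X.add_le _ _ (hf a) (Finset.measurable_sum _ fun i _ => hf i)).trans (by gcongr)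

lemma avg_step (X : RINorm μI) {δ : ℝ} (hδ : 0 < δ) {N : ℕ} (hN : 0 < N) (b : Fin N → ℝ≥0∞) :
    (∑ k, b k) * fund X (N * δ) ≤ N * X.N (stepF δ b) := by
  have : NeZero N := ⟨hN.ne'⟩
  have heq : ∀ j : Fin N, X.N (stepF δ (fun k => b (k + j))) = X.N (stepF δ b) := by
    intro j
    refine X.rearr_invariant _ _ (stepF_meas _ _) (stepF_meas _ _) fun l => ?_
    rw [stepF_dist hδ, stepF_dist hδ]
    exact Equiv.sum_comp (Equiv.addRight j) (fun k => if l < b k then ENNReal.ofReal δ else 0)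
  have hsum : X.N (fun x => ∑ j : Fin N, stepF δ (fun k => b (k + j)) x) ≤ N * X.N (stepF δ b) := by
    refine (X.sum_le _ _ fun j => stepF_meas _ _).trans ?_
    simp [heq]
  refine le_trans ?_ hsum
  refine ENNReal.mul_le_of_forall_lt fun a' ha' b' hb' => ?_
  lift a' to ℝ≥0 using (ne_top_of_lt ha')
  refine (mul_le_mul_right hb'.le _).trans ?_
  have hm : Measurable ((Ioo (0:ℝ) (N * δ)).indicator (fun _ => (1:ℝ≥0∞))) :=
    measurable_const.indicator measurableSet_Ioo
  rw [fund, ← X.smul_eq a' _ hm]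
  refine X.mono _ _ (measurable_const.mul hm)
    (Finset.measurable_sum _ fun j _ => stepF_meas _ _) (ae_of_all _ fun x => ?_)
  by_cases hx : x ∈ Ioo (0:ℝ) (N * δ)
  · obtain ⟨k, hk⟩ := stepI_cover hδ hx.1 hx.2.le
    simp only [indicator_of_mem hx, mul_one, stepF_eq hδ _ hk]
    refine ha'.le.trans (le_of_eq ?_)
    exact (Equiv.sum_comp (Equiv.addLeft k) b).symm
  · simp [indicator_of_notMem hx]

lemma avg_antitone (X : RINorm μI) (F : ℝ → ℝ≥0∞) (hF : Antitone F) {T : ℝ} (hT : 0 < T) :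
    (∫⁻ t in Ioo 0 T, F t) * fund X T ≤ ENNReal.ofReal T * X.N F := by
  have main : ∀ N : ℕ, 
      (∫⁻ t in Ioo (T / (N + 1)) T, F t) * fund X T ≤ ENNReal.ofReal T * X.N F := by
    intro N
    set δ : ℝ := T / (N + 1) with hδd
    have hδ : 0 < δ := by positivity
    have hTδ : ((N + 1 : ℕ) : ℝ) * δ = T := by
      rw [hδd]; push_cast; field_simp
    let b : Fin (N + 1) → ℝ≥0∞ := fun k => F (((k:ℕ) + 1 : ℝ) * δ)
    have h1 := avg_step X hδ (Nat.succ_pos N) b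
    rw [hTδ] at h1
    have h2 : X.N (stepF δ b) ≤ X.N F := by
      refine X.mono _ _ (stepF_meas _ _) hF.measurable ?_
      refine ae_of_all _ fun x => ?_
      by_cases hx : ∃ k : Fin (N+1), x ∈ stepI δ k
      · obtain ⟨k, hk⟩ := hx
        rw [stepF_eq hδ b hk]
        exact hF hk.2
      · push Not at hx
        have : stepF δ b x = 0 := Finset.sum_eq_zero fun k _ => indicator_of_notMem (hx k) _
        simp [this]
    have h3 : ∫⁻ t in Ioo δ T, F t ≤ ENNReal.ofReal δ * ∑ k, b k := by
      have hsub : Ioo δ T ⊆ ⋃ k : Fin (N+1), Ioc ((((k:ℕ):ℝ) + 1) * δ) ((((k:ℕ):ℝ) + 2) * δ) := by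
        intro x hx
        obtain ⟨k, hk⟩ := stepI_cover (N := N + 1) hδ (x := x - δ) (by linarith [hx.1])
          (by rw [hTδ]; linarith [hx.2])
        refine mem_iUnion.mpr ⟨k, ?_, ?_⟩
        · linarith [hk.1]
        · linarith [hk.2]
      refine (lintegral_mono_set hsub).trans ((lintegral_iUnion_le _ _).trans ?_)
      rw [tsum_fintype, Finset.mul_sum]
      refine Finset.sum_le_sum fun k _ => ?_
      calc ∫⁻ t in Ioc ((((k:ℕ):ℝ) + 1) * δ) ((((k:ℕ):ℝ) + 2) * δ), F t 
          ≤ ∫⁻ t in Ioc ((((k:ℕ):ℝ) + 1) * δ) ((((k:ℕ):ℝ) + 2) * δ), b k := 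
            setLIntegral_mono' measurableSet_Ioc fun t ht => hF ht.1.le
        _ = ENNReal.ofReal δ * b k := by
            rw [setLIntegral_const, Real.volume_Ioc, mul_comm]
            congr 2
            ring
    calc (∫⁻ t in Ioo δ T, F t) * fund X T ≤ (ENNReal.ofReal δ * ∑ k, b k) * fund X T := by gcongr
      _ = ENNReal.ofReal δ * ((∑ k, b k) * fund X T) := by ring
      _ ≤ ENNReal.ofReal δ * ((N + 1 : ℕ) * X.N F) := 
          mul_le_mul_right (h1.trans (mul_le_mul_right h2 _)) _
      _ = ENNReal.ofReal T * X.N F := by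
          rw [← mul_assoc]
          congr 1
          rw [← hTδ, mul_comm, ENNReal.ofReal_mul (by positivity), ENNReal.ofReal_natCast]
  have hU : Ioo 0 T = ⋃ N : ℕ, Ioo (T / (N + 1)) T := by
    ext x
    simp only [mem_iUnion, mem_Ioo]
    constructor
    · rintro ⟨h1, h2⟩
      obtain ⟨N, hN⟩ := exists_nat_gt (T / x)
      refine ⟨N, ?_, h2⟩
      rw [div_lt_iff₀ h1] at hN
      rw [div_lt_iff₀ (by positivity)]
      nlinarith
    · rintro ⟨N, h1, h2⟩
      exact ⟨lt_trans (by positivity) h1, h2⟩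
  rw [hU, setLIntegral_iUnion_of_directed]
  · rw [ENNReal.iSup_mul]
    exact iSup_le main
  · refine (monotone_nat_of_le_succ fun N => ?_).directed_le
    refine Ioo_subset_Ioo_left ?_
    push_cast
    gcongr
    linarith

lemma holder_fund {α : Type*} [MeasurableSpace α] (X : RINorm μI) (μ : Measure α) (w : α → ℝ)
    (hw0 : ∀ x, 0 ≤ w x) (hw : AEMeasurable w μ)
    (A : Set α) {T : ℝ} (hT : 0 < T) (hA : μ A = ENNReal.ofReal T) :
    (∫⁻ x in A, ENNReal.ofReal (w x) ∂μ) * fund X T ≤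
      ENNReal.ofReal T * X.N (rearr μ (fun x => ENNReal.ofReal (w x))) :=
  (mul_le_mul_left (hardy_littlewood μ w hw0 hw A T hA) _).trans
    (avg_antitone X _ (rearr_antitone _ _) hT)

end aux_avg

section aux_sobolev

/-- the dimensional constant -/
def cdim (n : ℕ) : ℝ := 2 / (n * (volume : Measure (Euc n)).real (Metric.ball 0 1))

lemma sum_single {n : ℕ} (x : Euc n) : ∑ i, x i • EuclideanSpace.single i (1:ℝ) = x := by
  have := (EuclideanSpace.basisFun (Fin n) ℝ).sum_repr x
  simpa using this

lemma div_radial {n : ℕ} (k : Euc n → ℝ) (x : Euc n) (hk : DifferentiableAt ℝ k x) :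
    ∑ i, fderiv ℝ (fun y : Euc n => y i * k y) x (EuclideanSpace.single i 1) =
      n * k x + fderiv ℝ k x x := by
  have h1 : ∀ i, fderiv ℝ (fun y : Euc n => y i * k y) x (EuclideanSpace.single i 1) =
      k x + x i * fderiv ℝ k x (EuclideanSpace.single i 1) := by
    intro i
    have h2 : HasFDerivAt (fun y : Euc n => y i) (EuclideanSpace.proj i : Euc n →L[ℝ] ℝ) x :=
      (EuclideanSpace.proj i : Euc n →L[ℝ] ℝ).hasFDerivAt
    have : fderiv ℝ (fun y : Euc n => y i * k y) x = _ := (h2.mul hk.hasFDerivAt).fderiv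
    rw [this]
    simp
    ring
  simp_rw [h1]
  rw [Finset.sum_add_distrib]
  congr 1
  · simp
  · conv_rhs => rw [← sum_single x]
    rw [map_sum]
    simp [sum_single]

lemma sqrt_sum_cs {n : ℕ} (a : Fin n → ℝ) (x : Euc n) (k : ℝ) :
    |∑ i, a i * (x i * k)| ≤ Real.sqrt (∑ i, a i ^ 2) * (‖x‖ * |k|) := by
  have h1 : ∑ i, a i * (x i * k) = (∑ i, a i * x i) * k := by
    rw [Finset.sum_mul]
    exact Finset.sum_congr rfl fun i _ => by ring
  rw [h1, abs_mul, ← mul_assoc]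
  refine mul_le_mul_of_nonneg_right ?_ (abs_nonneg _)
  rw [EuclideanSpace.norm_eq, ← Real.sqrt_mul (Finset.sum_nonneg fun i _ => sq_nonneg _)]
  refine Real.abs_le_sqrt ?_
  simpa using Finset.sum_mul_sq_le_sq_mul_sq Finset.univ a (fun i => x i)

lemma test_ineq (n : ℕ) (hn : 2 ≤ n) (u : Euc n → ℝ) (Du : Fin n → Euc n → ℝ) (g : ℝ → ℝ)
    (hg : ∀ x, u x = g ‖x‖) (hW : HasWeakGradient u Du) (θ : ℝ → ℝ) (hθ : ContDiff ℝ (⊤ : ℕ∞) θ)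
    (c d : ℝ) (hc : 0 < c) (hsupp : ∀ t, t ∉ Icc c d → θ t = 0) (hθ1 : ∀ t, |θ t| ≤ 1) :
    ENNReal.ofReal (n * (volume : Measure (Euc n)).real (Metric.ball 0 1)) * 
        ‖∫ t in Ioi (0:ℝ), deriv θ t * g t‖ₑ ≤
      ∫⁻ x in {x : Euc n | ‖x‖ ∈ Icc c d},
        ENNReal.ofReal (Real.sqrt (∑ i, Du i x ^ 2) * (‖x‖ ^ (n - 1))⁻¹) := by
  obtain ⟨m, rfl⟩ : ∃ m, n = m + 1 := ⟨n - 1, by omega⟩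
  obtain ⟨hu, hDu, hweak⟩ := hW
  let k : Euc (m+1) → ℝ := fun x => θ ‖x‖ * (‖x‖ ^ (m+1))⁻¹
  have hk0 : ∀ x, ‖x‖ ∉ Icc c d → k x = 0 := by
    intro x hx
    simp [k, hsupp _ hx]
  have hkc : ContDiff ℝ (⊤ : ℕ∞) k := by
    rw [contDiff_iff_contDiffAt]
    intro x
    by_cases hx : x = 0
    · have : k =ᶠ[𝓝 x] fun _ => 0 := by
        filter_upwards [Metric.ball_mem_nhds x hc] with y hy
        refine hk0 y fun h => ?_
        rw [hx, mem_ball_zero_iff] at hy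
        linarith [h.1]
      exact contDiffAt_const.congr_of_eventuallyEq this
    · have hnx := contDiffAt_norm (n := ((⊤ : ℕ∞) : WithTop ℕ∞)) ℝ hx
      exact (hθ.contDiffAt.comp x hnx).mul ((hnx.pow (m+1)).inv (by simpa using hx))
  let φ : Fin (m+1) → Euc (m+1) → ℝ := fun i x => x i * k x
  have hφc : ∀ i, ContDiff ℝ (⊤ : ℕ∞) (φ i) := by
    intro i
    exact (EuclideanSpace.proj i : Euc (m+1) →L[ℝ] ℝ).contDiff.mul hkc
  have hφs : ∀ i, HasCompactSupport (φ i) := by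
    intro i
    refine HasCompactSupport.intro (isCompact_closedBall (0 : Euc (m+1)) d) fun x hx => ?_
    have : k x = 0 := by
      refine hk0 x fun h => hx ?_
      simpa using h.2
    simp [φ, this]
  have hdiv : ∀ x : Euc (m+1), x ≠ 0 → ∑ i, fderiv ℝ (φ i) x (EuclideanSpace.single i 1) =
      deriv θ ‖x‖ * (‖x‖ ^ m)⁻¹ := by
    intro x hx
    have hnx : ‖x‖ ≠ 0 := by simpa using hx
    have hnd : DifferentiableAt ℝ (fun y : Euc (m+1) => ‖y‖) x :=
      (contDiffAt_norm (n := 1) ℝ hx).differentiableAt (by norm_num)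
    have hkd : HasDerivAt (fun s : ℝ => θ s * (s ^ (m+1))⁻¹)
        (deriv θ ‖x‖ * (‖x‖ ^ (m+1))⁻¹ +
          θ ‖x‖ * (-((((m + 1 : ℕ) : ℝ) * ‖x‖ ^ m)) / (‖x‖ ^ (m+1)) ^ 2)) ‖x‖ := by
      have h1 : HasDerivAt θ (deriv θ ‖x‖) ‖x‖ :=
        ((hθ.differentiable (by simp)) _).hasDerivAt
      have h2 := (hasDerivAt_pow (m+1) ‖x‖).inv (pow_ne_zero _ hnx)
      exact h1.mul h2
    have hkf := hkd.comp_hasFDerivAt x hnd.hasFDerivAt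
    have e1 : fderiv ℝ k x x = _ := congrArg (fun L => L x) hkf.fderiv
    rw [div_radial k x (hkc.differentiable (by simp) x), e1]
    simp only [_root_.smul_apply, smul_eq_mul, hnd.fderiv_norm_self, k]
    push_cast
    field_simp
    ring
  have hi1 : ∀ i, Integrable (fun x => u x * fderiv ℝ (φ i) x (EuclideanSpace.single i 1)) := by
    intro i
    refine hu.integrable_smul_right_of_hasCompactSupport ?_ ((hφs i).fderiv_apply ℝ _)
    exact ((hφc i).continuous_fderiv (by simp)).clm_apply continuous_const
  have hi2 : ∀ i, Integrable (fun x => Du i x * φ i x) := fun i =>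
    (hDu i).integrable_smul_right_of_hasCompactSupport (hφc i).continuous (hφs i)
  have hmain : ∫ x, u x * (deriv θ ‖x‖ * (‖x‖ ^ m)⁻¹) = -∫ x, ∑ i, Du i x * φ i x := by
    have e1 : ∫ x, u x * (deriv θ ‖x‖ * (‖x‖ ^ m)⁻¹) =
        ∫ x, ∑ i, u x * fderiv ℝ (φ i) x (EuclideanSpace.single i 1) := by
      refine integral_congr_ae ?_
      filter_upwards [Measure.ae_ne volume (0 : Euc (m+1))] with x hx
      rw [← hdiv x hx, Finset.mul_sum]
    rw [e1, integral_finsetSum _ fun i _ => hi1 i, integral_finsetSum _ fun i _ => hi2 i,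
      ← Finset.sum_neg_distrib]
    exact Finset.sum_congr rfl fun i _ => hweak i (φ i) (hφc i) (hφs i)
  have hpolar : ∫ x, u x * (deriv θ ‖x‖ * (‖x‖ ^ m)⁻¹) =
      ((m + 1 : ℕ) * (volume : Measure (Euc (m+1))).real (Metric.ball 0 1)) *
        ∫ t in Ioi (0:ℝ), deriv θ t * g t := by
    have := integral_fun_norm_addHaar (volume : Measure (Euc (m+1)))
      (fun s => g s * (deriv θ s * (s ^ m)⁻¹))
    simp only [finrank_euclideanSpace, Fintype.card_fin, Nat.add_sub_cancel, smul_eq_mul,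
      nsmul_eq_mul] at this
    simp_rw [hg]
    rw [this, ← mul_assoc]
    congr 1
    refine setIntegral_congr_fun measurableSet_Ioi fun t ht => ?_
    have : t ≠ 0 := ne_of_gt ht
    field_simp
  have hnn : (0:ℝ) ≤ (m + 1 : ℕ) * (volume : Measure (Euc (m+1))).real (Metric.ball 0 1) := by
    positivity
  have e1 : ENNReal.ofReal ((m + 1 : ℕ) * (volume : Measure (Euc (m+1))).real (Metric.ball 0 1)) *
        ‖∫ t in Ioi (0:ℝ), deriv θ t * g t‖ₑ = ‖∫ x, ∑ i, Du i x * φ i x‖ₑ := by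
    rw [← enorm_neg (∫ x, ∑ i, Du i x * φ i x), ← hmain, hpolar, enorm_mul,
      Real.enorm_of_nonneg hnn]
  rw [e1]
  have hms : MeasurableSet {x : Euc (m+1) | ‖x‖ ∈ Icc c d} :=
    measurable_norm measurableSet_Icc
  refine (enorm_integral_le_lintegral_enorm _).trans ?_
  rw [← lintegral_indicator hms]
  refine lintegral_mono fun x => ?_
  by_cases hx : x ∈ {x : Euc (m+1) | ‖x‖ ∈ Icc c d}
  · rw [indicator_of_mem hx, Real.enorm_eq_ofReal_abs]
    refine ENNReal.ofReal_le_ofReal ?_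
    refine (sqrt_sum_cs _ _ _).trans ?_
    refine mul_le_mul_of_nonneg_left ?_ (Real.sqrt_nonneg _)
    have hx0 : 0 < ‖x‖ := hc.trans_le hx.1
    have : ‖x‖ * |k x| = |θ ‖x‖| * (‖x‖ ^ m)⁻¹ := by
      simp only [k, abs_mul, abs_inv, abs_pow, abs_norm]
      field_simp
      ring
    rw [this]
    exact mul_le_of_le_one_left (by positivity) (hθ1 _)
  · have : k x = 0 := hk0 x hx
    simp [φ, this]

lemma integrableOn_profile (n : ℕ) (hn : 2 ≤ n) (u : Euc n → ℝ) (g : ℝ → ℝ)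
    (hg : ∀ x, u x = g ‖x‖) (hu : LocallyIntegrable u volume) (c d : ℝ) (hc : 0 < c) :
    IntegrableOn g (Icc c d) := by
  have : Nontrivial (Euc n) := by
    have : Nonempty (Fin n) := ⟨⟨0, by omega⟩⟩
    infer_instance
  have h1 : IntegrableOn (fun x : Euc n => g ‖x‖) (Metric.ball 0 (d + 1)) := by
    simp_rw [← hg]
    exact (hu.integrableOn_isCompact (isCompact_closedBall 0 (d+1))).mono_set
      Metric.ball_subset_closedBall
  rw [integrableOn_fun_norm_addHaar] at h1
  have h2 := h1.mono_set (show Icc c d ⊆ Ioo 0 (d + 1) from fun x hx =>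
    ⟨hc.trans_le hx.1, by linarith [hx.2]⟩)
  have h3 := IntegrableOn.continuousOn_mul (g := fun y : ℝ => (y ^ (Module.finrank ℝ (Euc n) - 1))⁻¹)
    (ContinuousOn.inv₀ (by fun_prop) fun y hy => pow_ne_zero _ (hc.trans_le hy.1).ne') h2 isCompact_Icc
  refine h3.congr_fun (fun y hy => ?_) measurableSet_Icc
  have : y ≠ 0 := (hc.trans_le hy.1).ne'
  simp only [smul_eq_mul]
  field_simp

end aux_sobolev

section aux_sobolev2

/-- shrinking bumps -/
def bmp (j : ℕ) : ContDiffBump (0:ℝ) where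
  rIn := 1 / (2 * ((j:ℝ) + 1))
  rOut := 1 / ((j:ℝ) + 1)
  rIn_pos := by positivity
  rIn_lt_rOut := by
    apply one_div_lt_one_div_of_lt
    · positivity
    · linarith [(Nat.cast_nonneg j : (0:ℝ) ≤ j)]

lemma bmp_tendsto : Tendsto (fun j => (bmp j).rOut) atTop (𝓝 0) :=
  tendsto_one_div_add_atTop_nhds_zero_nat

open Convolution in
lemma bmp_ae (g : ℝ → ℝ) (hg : LocallyIntegrable g volume) : ∀ᵐ x₀ : ℝ,
    Tendsto (fun j => ((bmp j).normed volume ⋆[ContinuousLinearMap.lsmul ℝ ℝ, volume] g) x₀) atTop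
      (𝓝 (g x₀)) := by
  refine ContDiffBump.ae_convolution_tendsto_right_of_locallyIntegrable (K := 2) bmp_tendsto
    (Eventually.of_forall fun j => ?_) hg
  simp only [bmp]
  apply le_of_eq
  field_simp

/-- primitive of bump difference -/
def thet (j : ℕ) (r s t : ℝ) : ℝ := ∫ τ in (t - s)..(t - r), (bmp j).normed volume τ

lemma bmp_cont (j : ℕ) : Continuous ((bmp j).normed (volume : Measure ℝ)) :=
  (bmp j).continuous_normed

lemma thet_hasDeriv (j : ℕ) (r s t : ℝ) : HasDerivAt (thet j r s)
    ((bmp j).normed volume (t - r) - (bmp j).normed volume (t - s)) t := by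
  have hP : ∀ y, HasDerivAt (fun y => ∫ τ in (0:ℝ)..y, (bmp j).normed volume τ)
      ((bmp j).normed volume y) y := fun y =>
    intervalIntegral.integral_hasDerivAt_right ((bmp_cont j).intervalIntegrable _ _)
      (bmp_cont j).stronglyMeasurable.stronglyMeasurableAtFilter (bmp_cont j).continuousAt
  have h1 := (hP (t - r)).comp_sub_const t r
  have h2 := (hP (t - s)).comp_sub_const t s
  have h3 : thet j r s = fun t => (∫ τ in (0:ℝ)..(t - r), (bmp j).normed volume τ) -
      ∫ τ in (0:ℝ)..(t - s), (bmp j).normed volume τ := by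
    funext t
    rw [thet, intervalIntegral.integral_interval_sub_left] <;>
    exact (bmp_cont j).intervalIntegrable _ _
  rw [h3]
  exact h1.sub h2

lemma thet_deriv (j : ℕ) (r s : ℝ) : deriv (thet j r s) =
    fun t => (bmp j).normed volume (t - r) - (bmp j).normed volume (t - s) :=
  funext fun t => (thet_hasDeriv j r s t).deriv

lemma thet_smooth (j : ℕ) (r s : ℝ) : ContDiff ℝ (⊤ : ℕ∞) (thet j r s) := by
  rw [contDiff_infty_iff_deriv]
  refine ⟨fun t => (thet_hasDeriv j r s t).differentiableAt, ?_⟩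
  rw [thet_deriv]
  exact ((bmp j).contDiff_normed.comp (contDiff_id.sub contDiff_const)).sub
    ((bmp j).contDiff_normed.comp (contDiff_id.sub contDiff_const))

lemma bmp_zero (j : ℕ) {t : ℝ} (ht : (bmp j).rOut ≤ |t|) : (bmp j).normed volume t = 0 := by
  have := (bmp j).support_normed_eq (μ := (volume : Measure ℝ))
  by_contra hc
  have h2 : t ∈ Function.support ((bmp j).normed (volume : Measure ℝ)) := hc
  rw [this, mem_ball_zero_iff, Real.norm_eq_abs] at h2
  linarith

lemma thet_supp (j : ℕ) {r s δ : ℝ} (hrs : r ≤ s) (hδ : (bmp j).rOut ≤ δ) (t : ℝ)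
    (ht : t ∉ Icc (r - δ) (s + δ)) : thet j r s t = 0 := by
  have hp := (bmp j).rOut_pos
  rw [thet]
  refine intervalIntegral.integral_zero_ae (ae_of_all _ fun τ hτ => ?_)
  rw [uIoc_of_le (by linarith)] at hτ
  refine bmp_zero j ?_
  by_contra hc
  push Not at hc
  rw [abs_lt] at hc
  refine ht ⟨?_, ?_⟩
  · linarith [hτ.1, hτ.2]
  · linarith [hτ.1, hτ.2]

lemma thet_abs (j : ℕ) {r s : ℝ} (hrs : r ≤ s) (t : ℝ) : |thet j r s t| ≤ 1 := by
  have h0 : 0 ≤ thet j r s t :=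
    intervalIntegral.integral_nonneg (by linarith) fun τ _ => (bmp j).nonneg_normed τ
  rw [abs_of_nonneg h0, thet, intervalIntegral.integral_of_le (by linarith),
    ← (bmp j).integral_normed (μ := (volume : Measure ℝ))]
  exact setIntegral_le_integral (bmp j).integrable_normed
    (ae_of_all _ fun τ => (bmp j).nonneg_normed τ)

/-- truncated profile -/
def trunc (g : ℝ → ℝ) (k : ℕ) : ℝ → ℝ := (Icc (1 / ((k:ℝ) + 1)) ((k:ℝ) + 1)).indicator g

open Convolution in
/-- good points -/
def good (g : ℝ → ℝ) : Set ℝ := {r | ∀ k : ℕ,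
    Tendsto (fun j => ((bmp j).normed volume ⋆[ContinuousLinearMap.lsmul ℝ ℝ, volume] (trunc g k)) r)
      atTop (𝓝 (trunc g k r))}

lemma good_ae (g : ℝ → ℝ) (hg : ∀ c d : ℝ, 0 < c → IntegrableOn g (Icc c d)) :
    ∀ᵐ r : ℝ, r ∈ good g := by
  have : ∀ᵐ r : ℝ, ∀ k : ℕ, _ := ae_all_iff.mpr fun k => bmp_ae (trunc g k)
    (((hg _ _ (by positivity)).integrable_indicator measurableSet_Icc).locallyIntegrable)
  exact this

lemma good_ineq (n : ℕ) (hn : 2 ≤ n) (u : Euc n → ℝ) (Du : Fin n → Euc n → ℝ) (g : ℝ → ℝ)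
    (hg : ∀ x, u x = g ‖x‖) (hW : HasWeakGradient u Du) {r s : ℝ} (hr0 : 0 < r) (hrs : r ≤ s)
    (hr : r ∈ good g) (hs : s ∈ good g) :
    ENNReal.ofReal (n * (volume : Measure (Euc n)).real (Metric.ball 0 1)) * ‖g r - g s‖ₑ ≤
      ∫⁻ x in {x : Euc n | ‖x‖ ∈ Icc r s},
        ENNReal.ofReal (Real.sqrt (∑ i, Du i x ^ 2) * (‖x‖ ^ (n - 1))⁻¹) := by
  have hgi := integrableOn_profile n hn u g hg hW.1
  set κ := ENNReal.ofReal (n * (volume : Measure (Euc n)).real (Metric.ball 0 1)) with hκ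
  set w : Euc n → ℝ≥0∞ := fun x =>
    ENNReal.ofReal (Real.sqrt (∑ i, Du i x ^ 2) * (‖x‖ ^ (n - 1))⁻¹) with hw
  obtain ⟨k, hk1, hk2⟩ : ∃ k : ℕ, 1 / ((k:ℝ) + 1) < r / 2 ∧ s + 1 < (k:ℝ) + 1 := by
    obtain ⟨k1, h1⟩ := exists_nat_one_div_lt (show 0 < r / 2 by linarith)
    obtain ⟨k2, h2⟩ := exists_nat_gt s
    refine ⟨max k1 k2, lt_of_le_of_lt ?_ h1, ?_⟩
    · apply one_div_le_one_div_of_le (by positivity)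
      push_cast
      linarith [le_max_left (k1:ℝ) k2]
    · push_cast
      linarith [le_max_right (k1:ℝ) k2]
  have hmem : ∀ t, r / 2 ≤ t → t ≤ s + 1 → t ∈ Icc (1 / ((k:ℝ) + 1)) ((k:ℝ) + 1) := fun t h1 h2 =>
    ⟨by linarith, by linarith⟩
  have htr : ∀ t, r / 2 ≤ t → t ≤ s + 1 → trunc g k t = g t := fun t h1 h2 =>
    indicator_of_mem (hmem t h1 h2) _
  have hδ : ∀ δ : ℝ, 0 < δ → δ ≤ r / 2 → δ ≤ 1 →
      κ * ‖g r - g s‖ₑ ≤ ∫⁻ x in {x : Euc n | ‖x‖ ∈ Icc (r - δ) (s + δ)}, w x := by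
    intro δ h0 h1 h2
    have hlim := ENNReal.Tendsto.const_mul ((hr k).sub (hs k)).enorm
      (a := κ) (Or.inr ENNReal.ofReal_ne_top)
    rw [htr r (by linarith) (by linarith), htr s (by linarith) (by linarith)] at hlim
    refine le_of_tendsto hlim ?_
    filter_upwards [bmp_tendsto.eventually (gt_mem_nhds h0)] with j hj
    have ht := test_ineq n hn u Du g hg hW (thet j r s) (thet_smooth j r s) (r - δ) (s + δ)
      (by linarith) (thet_supp j hrs hj.le) (thet_abs j hrs)
    refine le_trans (le_of_eq ?_) ht
    congr 2
    have hti : Integrable (trunc g k) :=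
      (hgi _ _ (by positivity)).integrable_indicator measurableSet_Icc
    have hint : ∀ y : ℝ, Integrable (fun t => (bmp j).normed volume (t - y) * trunc g k t) := by
      intro y
      exact hti.locallyIntegrable.integrable_smul_left_of_hasCompactSupport
        ((bmp_cont j).comp (continuous_id.sub continuous_const))
        ((bmp j).hasCompactSupport_normed.comp_homeomorph (Homeomorph.subRight y))
    have hconv : ∀ y : ℝ, (MeasureTheory.convolution ((bmp j).normed volume) (trunc g k)
        (ContinuousLinearMap.lsmul ℝ ℝ) volume) y =
        ∫ t, (bmp j).normed volume (t - y) * trunc g k t := by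
      intro y
      rw [convolution_lsmul_swap]
      refine integral_congr_ae (ae_of_all _ fun t => ?_)
      simp only [smul_eq_mul]
      rw [← neg_sub, ContDiffBump.normed_neg]
    rw [hconv, hconv, ← integral_sub (hint r) (hint s), thet_deriv]
    have hz : ∀ t, t ∉ Icc (r - δ) (s + δ) →
        (bmp j).normed volume (t - r) - (bmp j).normed volume (t - s) = 0 := by
      intro t ht
      rw [bmp_zero, bmp_zero, sub_zero]
      · by_contra hc
        push Not at hc
        rw [abs_lt] at hc
        exact ht ⟨by linarith, by linarith⟩
      · by_contra hc
        push Not at hc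
        rw [abs_lt] at hc
        exact ht ⟨by linarith, by linarith⟩
    rw [setIntegral_eq_integral_of_forall_compl_eq_zero]
    · refine integral_congr_ae (ae_of_all _ fun t => ?_)
      simp only
      by_cases ht : t ∈ Icc (r - δ) (s + δ)
      · rw [htr t (by linarith [ht.1]) (by linarith [ht.2])]
        ring
      · rw [← sub_mul, hz t ht]
        ring
    · intro t ht
      have h9 := hz t (fun h => ht (lt_of_lt_of_le (by linarith) h.1))
      simp only [h9, zero_mul]
  -- let δ tend to zero
  let δ : ℕ → ℝ := fun m => min (r / 2) 1 / ((m:ℝ) + 1)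
  have hmin : 0 < min (r / 2) 1 := lt_min (by linarith) one_pos
  have hδ0 : ∀ m, 0 < δ m := fun m => by positivity
  have hδ1 : ∀ m, δ m ≤ min (r / 2) 1 := fun m =>
    div_le_self hmin.le (by linarith [(Nat.cast_nonneg m : (0:ℝ) ≤ m)])
  have hδa : Antitone δ := by
    intro a b hab
    have : (a:ℝ) ≤ b := by exact_mod_cast hab
    simp only [δ]
    gcongr
  have hδt : Tendsto δ atTop (𝓝 0) := by
    have := (tendsto_one_div_add_atTop_nhds_zero_nat (𝕜 := ℝ)).const_mul (min (r/2) 1)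
    simpa [δ, div_eq_mul_inv] using this
  let E : ℕ → Set (Euc n) := fun m => {x : Euc n | ‖x‖ ∈ Icc (r - δ m) (s + δ m)}
  have hEm : ∀ a b : ℝ, MeasurableSet {x : Euc n | ‖x‖ ∈ Icc a b} := fun a b =>
    measurable_norm measurableSet_Icc
  have hEa : Antitone E := by
    intro a b hab x hx
    have := hδa hab
    exact ⟨by linarith [hx.1], by linarith [hx.2]⟩
  have hEi : ⋂ m, E m = {x : Euc n | ‖x‖ ∈ Icc r s} := by
    ext x
    simp only [mem_iInter, E, mem_ofPred_eq, mem_Icc]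
    constructor
    · intro h
      constructor
      · have h1 : Tendsto (fun m => r - δ m) atTop (𝓝 (r - 0)) := tendsto_const_nhds.sub hδt
        have := le_of_tendsto' h1 fun m => (h m).1
        linarith
      · have h1 : Tendsto (fun m => s + δ m) atTop (𝓝 (s + 0)) := tendsto_const_nhds.add hδt
        have := ge_of_tendsto' h1 fun m => (h m).2
        linarith
    · rintro ⟨h1, h2⟩ m
      exact ⟨by linarith [hδ0 m], by linarith [hδ0 m]⟩
  have hfin : (volume.withDensity w) (E 0) ≠ ∞ := by
    rw [withDensity_apply _ (hEm _ _)]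
    have hD : ∀ i, IntegrableOn (Du i) (Metric.closedBall 0 (s + 1)) := fun i =>
      (hW.2.1 i).integrableOn_isCompact (isCompact_closedBall _ _)
    have hsub : E 0 ⊆ Metric.closedBall 0 (s + 1) := by
      intro x hx
      simp only [mem_closedBall_zero_iff]
      linarith [hx.2, hδ1 0, min_le_right (r/2) 1]
    have hbd : ∀ x ∈ E 0, w x ≤ ENNReal.ofReal (((r / 2) ^ (n - 1))⁻¹) * ∑ i, ‖Du i x‖ₑ := by
      intro x hx
      have hxr : r / 2 ≤ ‖x‖ := by linarith [hx.1, hδ1 0, min_le_left (r/2) 1]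
      have e1 : ∑ i, ‖Du i x‖ₑ = ENNReal.ofReal (∑ i, |Du i x|) := by
        rw [ENNReal.ofReal_sum_of_nonneg fun i _ => abs_nonneg _]
        exact Finset.sum_congr rfl fun i _ => Real.enorm_eq_ofReal_abs _
      rw [e1, ← ENNReal.ofReal_mul (by positivity), hw]
      refine ENNReal.ofReal_le_ofReal ?_
      rw [mul_comm]
      refine mul_le_mul ?_ ?_ (Real.sqrt_nonneg _) (by positivity)
      · gcongr
      · refine Real.sqrt_le_iff.mpr ⟨Finset.sum_nonneg fun i _ => abs_nonneg _, ?_⟩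
        calc ∑ i, Du i x ^ 2 = ∑ i, |Du i x| ^ 2 := by simp
          _ ≤ (∑ i, |Du i x|) ^ 2 := Finset.sum_sq_le_sq_sum_of_nonneg fun i _ => abs_nonneg _
    refine ne_top_of_le_ne_top ?_ ((setLIntegral_mono' (hEm _ _) hbd).trans
      (lintegral_mono_set hsub))
    rw [lintegral_const_mul' _ _ ENNReal.ofReal_ne_top, lintegral_finsetSum']
    · refine ENNReal.mul_ne_top ENNReal.ofReal_ne_top ?_
      refine (ENNReal.sum_lt_top.mpr fun i _ => ?_).ne
      exact (hD i).2
    · exact fun i _ => (hD i).1.enorm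
  have hlim := tendsto_measure_iInter_atTop (μ := volume.withDensity w) (s := E)
    (fun m => (hEm _ _).nullMeasurableSet) hEa ⟨0, hfin⟩
  rw [hEi, withDensity_apply _ (hEm _ _)] at hlim
  refine ge_of_tendsto' hlim fun m => ?_
  simp only [Function.comp_apply]
  rw [withDensity_apply _ (hEm _ _)]
  exact hδ (δ m) (hδ0 m) ((hδ1 m).trans (min_le_left _ _)) ((hδ1 m).trans (min_le_right _ _))

lemma ae_norm (n : ℕ) (hn : 2 ≤ n) (S : Set ℝ) (hS : ∀ᵐ r : ℝ, r ∈ S) :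
    ∀ᵐ x : Euc n, ‖x‖ ∈ S := by
  have : Nontrivial (Euc n) := by
    have : Nonempty (Fin n) := ⟨⟨0, by omega⟩⟩
    infer_instance
  set N := toMeasurable volume (Sᶜ) with hN
  have hN0 : volume N = 0 := by
    rw [hN, measure_toMeasurable]
    exact hS
  have hNm : MeasurableSet N := measurableSet_toMeasurable _ _
  have hz : ∀ᵐ y ∂(volume.restrict (Ioi (0:ℝ))),
      y ^ (Module.finrank ℝ (Euc n) - 1) • N.indicator (fun _ => (1:ℝ)) y = 0 := by
    refine ae_restrict_of_ae ?_
    filter_upwards [measure_eq_zero_iff_ae_notMem.mp hN0] with y hy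
    simp [indicator_of_notMem hy]
  have hi : Integrable (fun x : Euc n => N.indicator (fun _ => (1:ℝ)) ‖x‖) := by
    rw [integrable_fun_norm_addHaar (volume : Measure (Euc n)) (f := N.indicator (fun _ => (1:ℝ)))]
    exact (integrable_zero _ _ _).congr (by filter_upwards [hz] with y hy using hy.symm)
  have h0 : ∫ x : Euc n, N.indicator (fun _ => (1:ℝ)) ‖x‖ = 0 := by
    rw [integral_fun_norm_addHaar (volume : Measure (Euc n)) (N.indicator (fun _ => (1:ℝ))),
      integral_eq_zero_of_ae hz]
    simp
  rw [integral_eq_zero_iff_of_nonneg (fun x => indicator_nonneg (fun _ _ => zero_le_one) _) hi] at h0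
  filter_upwards [h0] with x hx
  by_contra hc
  have : ‖x‖ ∈ N := subset_toMeasurable _ _ hc
  simp [indicator_of_mem this] at hx

lemma radial_bound (n : ℕ) (hn : 2 ≤ n) (u : Euc n → ℝ) (Du : Fin n → Euc n → ℝ)
    (hrad : ∀ x y : Euc n, ‖x‖ = ‖y‖ → u x = u y) (hW : HasWeakGradient u Du) :
    ∀ᵐ x : Euc n, 0 < ‖x‖ → ∃ A : Set (Euc n), volume A = ENNReal.ofReal (2 * ‖x‖ ^ (n - 1)) ∧
      ENNReal.ofReal |u x| * ENNReal.ofReal (2 * ‖x‖ ^ (n - 1)) ≤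
        (∫⁻ y in A, ENNReal.ofReal |u y|) + ENNReal.ofReal (cdim n) *
          ∫⁻ y in A, ENNReal.ofReal (Real.sqrt (∑ i, Du i y ^ 2)) := by
  have : Nontrivial (Euc n) := by
    have : Nonempty (Fin n) := ⟨⟨0, by omega⟩⟩
    infer_instance
  let e : Euc n := EuclideanSpace.single ⟨0, by omega⟩ 1
  let g : ℝ → ℝ := fun s => u (s • e)
  have hg : ∀ x, u x = g ‖x‖ := by
    intro x
    refine hrad _ _ ?_
    simp [e, norm_smul]
  have hgi := integrableOn_profile n hn u g hg hW.1
  have hae := ae_norm n hn _ (good_ae g hgi)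
  set ω := (volume : Measure (Euc n)).real (Metric.ball 0 1) with hω
  have hω0 : 0 < ω := by
    refine ENNReal.toReal_pos (Metric.measure_ball_pos _ _ one_pos).ne' measure_ball_lt_top.ne
  have hn0 : (0:ℝ) < n := by
    have : 0 < n := by omega
    exact_mod_cast this
  filter_upwards [hae] with x hx hx0
  set r := ‖x‖ with hr
  set P := r ^ n + 2 / ω * r ^ (n - 1) with hP
  have hPp : r ^ n < P := by
    have : 0 < 2 / ω * r ^ (n - 1) := by positivity
    linarith
  have hP0 : 0 < P := lt_of_le_of_lt (by positivity) hPp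
  obtain ⟨r', hr'0, hr'⟩ : ∃ r' : ℝ, 0 ≤ r' ∧ r' ^ n = P :=
    ⟨P ^ ((n:ℝ)⁻¹), by positivity, Real.rpow_inv_natCast_pow hP0.le (by omega)⟩
  have hrr : r < r' := by
    refine lt_of_pow_lt_pow_left₀ n hr'0 ?_
    rw [hr']
    exact hPp
  let A : Set (Euc n) := Metric.ball 0 r' \ Metric.ball 0 r
  have hAm : MeasurableSet A := measurableSet_ball.diff measurableSet_ball
  have hωe : volume (Metric.ball (0 : Euc n) 1) = ENNReal.ofReal ω :=
    (ENNReal.ofReal_toReal measure_ball_lt_top.ne).symm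
  have hAv : volume A = ENNReal.ofReal (2 * r ^ (n - 1)) := by
    rw [measure_diff (Metric.ball_subset_ball hrr.le) measurableSet_ball.nullMeasurableSet
      measure_ball_lt_top.ne, Measure.addHaar_ball _ _ hr'0, Measure.addHaar_ball _ _ hx0.le,
      hωe, ← ENNReal.ofReal_mul (by positivity), ← ENNReal.ofReal_mul (by positivity),
      ← ENNReal.ofReal_sub _ (by positivity)]
    congr 1
    simp only [finrank_euclideanSpace, Fintype.card_fin]
    rw [hr', hP]
    field_simp
    ring
  refine ⟨A, hAv, ?_⟩
  set G : ℝ≥0∞ := ∫⁻ y in A, ENNReal.ofReal (Real.sqrt (∑ i, Du i y ^ 2)) with hG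
  have hκ0 : (0:ℝ) < n * ω := by positivity
  set D : ℝ≥0∞ := ENNReal.ofReal ((n * ω)⁻¹) * (ENNReal.ofReal ((r ^ (n - 1))⁻¹) * G) with hD
  have key : ∀ᵐ y : Euc n, y ∈ A → ENNReal.ofReal |u x| ≤ ENNReal.ofReal |u y| + D := by
    filter_upwards [hae] with y hy hyA
    have hy1 : ‖y‖ < r' := by simpa using hyA.1
    have hy2 : r ≤ ‖y‖ := by simpa using hyA.2
    have h1 := good_ineq n hn u Du g hg hW hx0 hy2 hx hy
    have h2 : ∫⁻ z in {z : Euc n | ‖z‖ ∈ Icc r ‖y‖},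
        ENNReal.ofReal (Real.sqrt (∑ i, Du i z ^ 2) * (‖z‖ ^ (n - 1))⁻¹) ≤ 
        ENNReal.ofReal ((r ^ (n - 1))⁻¹) * G := by
      have hsub : {z : Euc n | ‖z‖ ∈ Icc r ‖y‖} ⊆ A := by
        intro z hz
        refine ⟨?_, ?_⟩
        · simpa using lt_of_le_of_lt hz.2 hy1
        · simpa using hz.1
      refine (lintegral_mono_set hsub).trans ?_
      rw [hG, ← lintegral_const_mul' _ _ ENNReal.ofReal_ne_top]
      refine setLIntegral_mono' hAm fun z hz => ?_
      have hz2 : r ≤ ‖z‖ := by simpa using hz.2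
      rw [← ENNReal.ofReal_mul (by positivity), mul_comm]
      refine ENNReal.ofReal_le_ofReal ?_
      gcongr
    have h3 : ‖g r - g ‖y‖‖ₑ ≤ D := by
      have := mul_le_mul_right (h1.trans h2) (ENNReal.ofReal ((n * ω)⁻¹))
      rw [← mul_assoc, ← ENNReal.ofReal_mul (by positivity), inv_mul_cancel₀ hκ0.ne',
        ENNReal.ofReal_one, one_mul] at this
      exact this
    have h4 : u x = g r := hg x
    have h5 : u y = g ‖y‖ := hg y
    rw [← h4, ← h5, Real.enorm_eq_ofReal_abs] at h3
    refine le_trans ?_ (add_le_add le_rfl h3)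
    rw [← ENNReal.ofReal_add (abs_nonneg _) (abs_nonneg _)]
    refine ENNReal.ofReal_le_ofReal ?_
    have := abs_add_le (u y) (u x - u y)
    simpa using this
  calc ENNReal.ofReal |u x| * ENNReal.ofReal (2 * r ^ (n - 1)) 
      = ∫⁻ _ in A, ENNReal.ofReal |u x| := by rw [setLIntegral_const, hAv]
    _ ≤ ∫⁻ y in A, (ENNReal.ofReal |u y| + D) := 
        lintegral_mono_ae ((ae_restrict_iff' hAm).mpr key)
    _ = (∫⁻ y in A, ENNReal.ofReal |u y|) + D * ENNReal.ofReal (2 * r ^ (n - 1)) := by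
        rw [lintegral_add_right _ measurable_const, setLIntegral_const, hAv]
    _ = _ := by
        congr 1
        have : cdim n = (n * ω)⁻¹ * (r ^ (n - 1))⁻¹ * (2 * r ^ (n - 1)) := by
          rw [cdim, ← hω]
          field_simp
        rw [this, ENNReal.ofReal_mul (p := (n * ω)⁻¹ * (r ^ (n - 1))⁻¹) (by positivity),
          ENNReal.ofReal_mul (p := (n * ω)⁻¹) (by positivity), hD]
        ac_rfl

end aux_sobolev2

section aux_final

lemma fund_mono (X : RINorm μI) {s t : ℝ} (h : s ≤ t) : fund X s ≤ fund X t := by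
  refine X.mono _ _ (measurable_const.indicator measurableSet_Ioo)
    (measurable_const.indicator measurableSet_Ioo) (ae_of_all _ fun x => ?_)
  exact indicator_le_indicator_of_subset (Ioo_subset_Ioo_right h) (fun _ => zero_le) x

lemma fund_ne_zero (X : RINorm μI) {t : ℝ} (ht : 0 < t) : fund X t ≠ 0 := by
  intro h
  rw [fund, X.eq_zero_iff _ (measurable_const.indicator measurableSet_Ioo)] at h
  have h2 : μI (Ioo 0 t) = 0 := by
    refine measure_mono_null ?_ (ae_iff.mp h)
    intro x hx
    simp [hx.1, hx.2]
  rw [μI, Measure.restrict_apply' measurableSet_Ioi,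
    inter_eq_left.mpr (show Ioo 0 t ⊆ Ioi 0 from fun x hx => hx.1), Real.volume_Ioo] at h2
  simp at h2
  linarith

lemma fund_ne_top (X : RINorm μI) (t : ℝ) : fund X t ≠ ∞ := by
  refine (X.indicator_lt_top _ measurableSet_Ioo ?_).ne
  exact (Measure.restrict_apply_le _ _).trans_lt (by simp)

/-- the operator-type constant -/
def Kc (X Y : RINorm μI) (a : ℝ) : ℝ≥0∞ :=
  ⨆ (f : ℝ → ℝ≥0∞) (_ : Measurable f) (_ : X.N f ≤ 1),
    Y.N ((Set.Ioi a).indicator fun t => rearr μI f t)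

lemma le_Kc (X Y : RINorm μI) (a : ℝ) (f : ℝ → ℝ≥0∞) (hf : Measurable f) (hf1 : X.N f ≤ 1) :
    Y.N ((Set.Ioi a).indicator fun t => rearr μI f t) ≤ Kc X Y a :=
  le_iSup_of_le f (le_iSup_of_le hf (le_iSup_of_le hf1 le_rfl))

/-- scaled version -/
lemma le_Kc_mul (X Y : RINorm μI) (a : ℝ) (f : ℝ → ℝ≥0∞) (hf : Measurable f)
    (h0 : X.N f ≠ 0) (ht : X.N f ≠ ∞) :
    Y.N ((Set.Ioi a).indicator fun t => rearr μI f t) ≤ Kc X Y a * X.N f := by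
  have hq0 : (X.N f)⁻¹ ≠ 0 := ENNReal.inv_ne_zero.mpr ht
  have hqt : (X.N f)⁻¹ ≠ ∞ := ENNReal.inv_ne_top.mpr h0
  obtain ⟨c, hc⟩ : ∃ c : ℝ≥0, (c : ℝ≥0∞) = (X.N f)⁻¹ := ⟨_, ENNReal.coe_toNNReal hqt⟩
  have hc0 : c ≠ 0 := by
    rintro rfl
    exact hq0 (by simpa using hc.symm)
  have h1 := le_Kc X Y a (fun x => (c : ℝ≥0∞) * f x) (measurable_const.mul hf)
    (by rw [X.smul_eq c f hf, hc, ENNReal.inv_mul_cancel h0 ht])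
  have h2 : ((Set.Ioi a).indicator fun t => rearr μI (fun x => (c : ℝ≥0∞) * f x) t)
      = fun t => (c : ℝ≥0∞) * (Set.Ioi a).indicator (fun t => rearr μI f t) t := by
    funext t
    by_cases h : t ∈ Ioi a
    · simp only [indicator_of_mem h]
      exact rearr_smul _ _ _ hc0 _
    · simp [indicator_of_notMem h]
  rw [h2, Y.smul_eq c _ ((rearr_measurable _ _).indicator measurableSet_Ioi), hc] at h1
  rw [← ENNReal.div_le_iff h0 ht, div_eq_mul_inv, mul_comm]
  exact h1

lemma fund_le_Kc (X Y : RINorm μI) {a : ℝ} (ha : 0 < a) :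
    fund Y a ≤ Kc X Y a * fund X (2 * a) := by
  have hm : ∀ s t : ℝ, Measurable ((Ioo s t).indicator (fun _ => (1:ℝ≥0∞))) := fun s t =>
    measurable_const.indicator measurableSet_Ioo
  refine le_trans ?_ (le_Kc_mul X Y a _ (hm 0 (2 * a)) (fund_ne_zero X (by linarith))
    (fund_ne_top X _))
  have hd : ∀ s t : ℝ, 0 ≤ s → ∀ l : ℝ≥0∞, μI {x | l < (Ioo s t).indicator (fun _ => (1:ℝ≥0∞)) x}
      = if l < 1 then ENNReal.ofReal (t - s) else 0 := by
    intro s t hs l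
    by_cases hl : l < 1
    · have : {x | l < (Ioo s t).indicator (fun _ => (1:ℝ≥0∞)) x} = Ioo s t := by
        ext x
        by_cases hx : x ∈ Ioo s t
        · simp only [mem_ofPred_eq, indicator_of_mem hx, hl, hx]
        · simp only [mem_ofPred_eq, indicator_of_notMem hx, hx, not_lt_zero]
      rw [this, if_pos hl, μI, Measure.restrict_apply' measurableSet_Ioi,
        inter_eq_left.mpr (show Ioo s t ⊆ Ioi 0 from fun x hx => lt_of_le_of_lt hs hx.1),
        Real.volume_Ioo]
    · have : {x | l < (Ioo s t).indicator (fun _ => (1:ℝ≥0∞)) x} = ∅ := by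
        ext x
        by_cases hx : x ∈ Ioo s t
        · simp only [mem_ofPred_eq, indicator_of_mem hx, hl, mem_empty_iff_false]
        · simp only [mem_ofPred_eq, indicator_of_notMem hx, mem_empty_iff_false, not_lt_zero]
      rw [this, if_neg hl, measure_empty]
  have h1 : fund Y a = Y.N ((Ioo a (2 * a)).indicator (fun _ => 1)) := by
    refine Y.rearr_invariant _ _ (hm _ _) (hm _ _) fun l => ?_
    rw [hd _ _ le_rfl, hd _ _ ha.le]
    congr 2
    ring
  rw [h1]
  refine Y.mono _ _ (hm _ _) ((rearr_measurable _ _).indicator measurableSet_Ioi)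
    (ae_of_all _ fun x => ?_)
  by_cases hx : x ∈ Ioo a (2 * a)
  · rw [indicator_of_mem hx, indicator_of_mem (show x ∈ Ioi a from hx.1)]
    refine le_of_forall_lt fun l hl => ?_
    rw [lt_rearr_iff, hd _ _ le_rfl, if_pos hl]
    exact (ENNReal.ofReal_lt_ofReal_iff (by linarith)).mpr (by linarith [hx.2])
  · simp [indicator_of_notMem hx]

lemma tail_core (n : ℕ) (hn : 2 ≤ n) (X Y : RINorm μI) (u : Euc n → ℝ) (Du : Fin n → Euc n → ℝ)
    (hrad : ∀ x y : Euc n, ‖x‖ = ‖y‖ → u x = u y) (hW : HasWeakGradient u Du)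
    (R : ℝ) (hR : 0 < R) :
    Y.N (fun t => rearrR volume ({x : Euc n | R ≤ ‖x‖}.indicator u) t) ≤
      ENNReal.ofReal (2 + cdim n) * Kc X Y (R ^ (n - 1)) *
        (X.N (fun t => rearrR volume u t) +
          X.N (fun t => rearrR volume (fun x => Real.sqrt (∑ i, Du i x ^ 2)) t)) := by
  set a := R ^ (n - 1) with ha
  have ha0 : 0 < a := by positivity
  set K := Kc X Y a with hK
  have hc0 : 0 ≤ cdim n := by unfold cdim; positivity
  set p := X.N (fun t => rearrR volume u t) with hp
  set q := X.N (fun t => rearrR volume (fun x => Real.sqrt (∑ i, Du i x ^ 2)) t) with hq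
  have hKf := fund_le_Kc X Y ha0
  have hK0 : K ≠ 0 := by
    intro h
    rw [← hK, h, zero_mul] at hKf
    exact fund_ne_zero Y ha0 (le_antisymm hKf zero_le)
  have hC0 : ENNReal.ofReal (2 + cdim n) ≠ 0 := by
    simp only [ne_eq, ENNReal.ofReal_eq_zero, not_le]
    linarith
  by_cases hV : p + q = ∞
  · rw [hV, ENNReal.mul_top (mul_ne_zero hC0 hK0)]
    exact le_top
  have hpt : p ≠ ∞ := fun h => hV (by simp [h])
  have hqt : q ≠ ∞ := fun h => hV (by simp [h])
  have hb0 := fund_ne_zero X (show 0 < 2 * a by linarith)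
  have hbt := fund_ne_top X (2 * a)
  set h : ℝ → ℝ≥0∞ := fun t => rearrR volume ({x : Euc n | R ≤ ‖x‖}.indicator u) t with hh
  have hhm : Measurable h := rearr_measurable _ _
  have hum : Measurable (fun t => rearrR volume u t) := rearr_measurable _ _
  have hhu : ∀ t, h t ≤ rearrR volume u t := by
    intro t
    refine rearr_mono _ (ae_of_all _ fun x => ?_) t
    by_cases hx : x ∈ {x : Euc n | R ≤ ‖x‖}
    · simp [indicator_of_mem hx]
    · simp [indicator_of_notMem hx]
  -- the tail part
  have hT : Y.N ((Ioi a).indicator h) ≤ K * p := by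
    by_cases hp0 : p = 0
    · have h1 := (X.eq_zero_iff _ hum).mp hp0
      have h2 : Y.N ((Ioi a).indicator h) = 0 := by
        rw [Y.eq_zero_iff _ (hhm.indicator measurableSet_Ioi)]
        filter_upwards [h1] with t ht
        have : h t = 0 := le_antisymm ((hhu t).trans (le_of_eq ht)) zero_le
        by_cases hx : t ∈ Ioi a
        · simp [indicator_of_mem hx, this]
        · simp [indicator_of_notMem hx]
      rw [h2]
      exact zero_le
    · refine le_trans ?_ (le_Kc_mul X Y a _ hum hp0 hpt)
      refine Y.mono _ _ (hhm.indicator measurableSet_Ioi)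
        ((rearr_measurable _ _).indicator measurableSet_Ioi) (ae_of_all _ fun t => ?_)
      refine indicator_le_indicator ?_
      refine (hhu t).trans (le_of_eq ?_)
      exact (rearr_rearr _ _ _).symm
  -- the head part
  set V : ℝ≥0∞ := p + ENNReal.ofReal (cdim n) * q with hVd
  have hVt : V ≠ ∞ := ENNReal.add_ne_top.mpr ⟨hpt, ENNReal.mul_ne_top ENNReal.ofReal_ne_top hqt⟩
  have hsup : ∀ t, h t ≤ V / fund X (2 * a) := by
    refine rearr_le_of_ae _ ?_
    filter_upwards [radial_bound n hn u Du hrad hW] with x hx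
    by_cases hxR : x ∈ {x : Euc n | R ≤ ‖x‖}
    · rw [indicator_of_mem hxR]
      have hxR' : R ≤ ‖x‖ := hxR
      obtain ⟨A, hA, hb⟩ := hx (hR.trans_le hxR')
      set T := 2 * ‖x‖ ^ (n - 1) with hTd
      have hT0 : 0 < T := by
        have := hR.trans_le hxR'
        positivity
      have haT : 2 * a ≤ T := by
        rw [hTd, ha]
        gcongr
      have e1 := holder_fund X volume (fun y => |u y|) (fun _ => abs_nonneg _)
        (hW.1.aestronglyMeasurable.aemeasurable.abs) A hT0 hA
      have e2 := holder_fund X volume (fun x => Real.sqrt (∑ i, Du i x ^ 2))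
        (fun _ => Real.sqrt_nonneg _) (by
          have := fun i => (hW.2.1 i).aestronglyMeasurable.aemeasurable
          fun_prop) A hT0 hA
      have e3 : X.N (rearr volume (fun x => ENNReal.ofReal (Real.sqrt (∑ i, Du i x ^ 2)))) = q := by
        rw [hq]
        unfold rearrR
        simp_rw [abs_of_nonneg (Real.sqrt_nonneg _)]
      rw [e3] at e2
      have e1' : (∫⁻ y in A, ENNReal.ofReal |u y|) * fund X T ≤ ENNReal.ofReal T * p := e1
      rw [ENNReal.le_div_iff_mul_le (Or.inl hb0) (Or.inl hbt)]
      have hT1 : ENNReal.ofReal T ≠ 0 := by simpa using hT0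
      have e4 : ENNReal.ofReal T * (ENNReal.ofReal |u x| * fund X (2 * a)) ≤
          ENNReal.ofReal T * V := by
        calc ENNReal.ofReal T * (ENNReal.ofReal |u x| * fund X (2 * a)) 
            = (ENNReal.ofReal |u x| * ENNReal.ofReal T) * fund X (2 * a) := by ring
          _ ≤ ((∫⁻ y in A, ENNReal.ofReal |u y|) + ENNReal.ofReal (cdim n) *
          ∫⁻ y in A, ENNReal.ofReal (Real.sqrt (∑ i, Du i y ^ 2))) * fund X T :=
              mul_le_mul' hb (fund_mono X haT)
          _ = (∫⁻ y in A, ENNReal.ofReal |u y|) * fund X T + ENNReal.ofReal (cdim n) *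
          ((∫⁻ y in A, ENNReal.ofReal (Real.sqrt (∑ i, Du i y ^ 2))) * fund X T) := by ring
          _ ≤ ENNReal.ofReal T * p + ENNReal.ofReal (cdim n) * (ENNReal.ofReal T * q) :=
              add_le_add e1' (mul_le_mul_right e2 _)
          _ = ENNReal.ofReal T * V := by rw [hVd]; ring
      exact (ENNReal.mul_le_mul_iff_right hT1 ENNReal.ofReal_ne_top).mp e4
    · simp [indicator_of_notMem hxR]
  obtain ⟨B, hB⟩ : ∃ B : ℝ≥0, (B : ℝ≥0∞) = V / fund X (2 * a) :=
    ⟨_, ENNReal.coe_toNNReal (ENNReal.div_ne_top hVt hb0)⟩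
  have hH : Y.N ((Ioo 0 a).indicator h) ≤ K * V := by
    have hm : Measurable ((Ioo 0 a).indicator (fun _ => (1:ℝ≥0∞))) :=
      measurable_const.indicator measurableSet_Ioo
    calc Y.N ((Ioo 0 a).indicator h) 
        ≤ Y.N (fun t => (B : ℝ≥0∞) * (Ioo 0 a).indicator (fun _ => (1:ℝ≥0∞)) t) := by
          refine Y.mono _ _ (hhm.indicator measurableSet_Ioo) (measurable_const.mul hm)
            (ae_of_all _ fun t => ?_)
          by_cases ht : t ∈ Ioo 0 a
          · simp only [indicator_of_mem ht, mul_one]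
            rw [hB]
            exact hsup t
          · simp [indicator_of_notMem ht]
      _ = V / fund X (2 * a) * fund Y a := by rw [Y.smul_eq B _ hm, hB]; rfl
      _ ≤ V / fund X (2 * a) * (K * fund X (2 * a)) := mul_le_mul_right hKf _
      _ = K * (V / fund X (2 * a) * fund X (2 * a)) := by ring
      _ = K * V := by rw [ENNReal.div_mul_cancel hb0 hbt]
  have hsplit : Y.N h ≤ Y.N ((Ioo 0 a).indicator h) + Y.N ((Ioi a).indicator h) := by
    refine le_trans (Y.mono _ _ hhm ((hhm.indicator measurableSet_Ioo).add
      (hhm.indicator measurableSet_Ioi)) ?_)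
      (Y.add_le _ _ (hhm.indicator measurableSet_Ioo) (hhm.indicator measurableSet_Ioi))
    have h1 : ∀ᵐ t ∂μI, t ∈ Ioi (0:ℝ) := ae_restrict_mem measurableSet_Ioi
    have h2 : ∀ᵐ t ∂μI, t ≠ a := ae_restrict_of_ae (Measure.ae_ne volume a)
    filter_upwards [h1, h2] with t ht1 ht2
    rcases lt_or_gt_of_ne ht2 with h3 | h3
    · simp [indicator_of_mem (show t ∈ Ioo 0 a from ⟨ht1, h3⟩)]
    · simp [indicator_of_mem (show t ∈ Ioi a from h3)]
  calc Y.N h ≤ K * V + K * p := hsplit.trans (add_le_add hH hT)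
    _ = K * (2 * p + ENNReal.ofReal (cdim n) * q) := by rw [hVd]; ring
    _ ≤ K * ((2 + ENNReal.ofReal (cdim n)) * p + (2 + ENNReal.ofReal (cdim n)) * q) := by
        gcongr
        · exact le_self_add
        · exact le_add_self
    _ = ENNReal.ofReal (2 + cdim n) * K * (p + q) := by
        rw [ENNReal.ofReal_add (by norm_num) hc0]
        simp only [ENNReal.ofReal_ofNat]
        ring

end aux_final

/-- quantitative decay of the `Y`-norm of the tail of a radially symmetric
Sobolev function (Proposition 1.2 of the paper, first-order case). -/
theorem tail_norm_estimate_radial (n : ℕ) (hn : 2 ≤ n) :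
    ∃ C : ℝ, 0 < C ∧
      ∀ (X Y : RINorm μI) (u : Euc n → ℝ) (Du : Fin n → Euc n → ℝ),
        (∀ x y : Euc n, ‖x‖ = ‖y‖ → u x = u y) →
        HasWeakGradient u Du →
        ∀ R : ℝ, 0 < R →
          Y.N (fun t => rearrR volume ({x : Euc n | R ≤ ‖x‖}.indicator u) t) ≤
            ENNReal.ofReal C *
              (⨆ (f : ℝ → ℝ≥0∞) (_ : Measurable f) (_ : X.N f ≤ 1),
                  Y.N ((Set.Ioi (R ^ (n - 1))).indicator fun t => rearr μI f t)) *
              (X.N (fun t => rearrR volume u t) +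
                X.N (fun t => rearrR volume (fun x => Real.sqrt (∑ i, Du i x ^ 2)) t)) := by
  have hc0 : 0 ≤ cdim n := by unfold cdim; positivity
  refine ⟨2 + cdim n, by linarith, ?_⟩
  intro X Y u Du hrad hW R hR
  exact tail_core n hn X Y u Du hrad hW R hR

end
end
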